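/- arXiv:1412.8416 — 10 statements merged into one kernel-verified Lean document; each statement's English description precedes it below -/
import Mathlib

section
/- Assume H ≠ 0 and strict feasibility, i.e., c/r^max + w/f_T < T̃. Then a pair (Q★, f★) ∈ X_s is a global minimizer of the energy E(Q) = c·tr(Q)/r(Q) over X_s if and only if it is a global minimizer of the transmit power tr(Q) over X_s (equivalence of the energy-minimization problem P_s and the power-minimization problem Q_s). -/
open Matrix ComplexOrder

/-- Achievable rate `r(Q) = log₂ det(I + Hᴴ R_w⁻¹ H Q)` (real part of the determinant,
which is real and `≥ 1` for PSD `Q`). -/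
noncomputable def rate {nT nR : ℕ} (H : Matrix (Fin nR) (Fin nT) ℂ)
    (Rw : Matrix (Fin nR) (Fin nR) ℂ) (Q : Matrix (Fin nT) (Fin nT) ℂ) : ℝ :=
  Real.logb 2 ((1 + Hᴴ * Rw⁻¹ * H * Q).det).re

/-- Energy `E(Q) = c · tr(Q) / r(Q)`. -/
noncomputable def energy {nT nR : ℕ} (H : Matrix (Fin nR) (Fin nT) ℂ)
    (Rw : Matrix (Fin nR) (Fin nR) ℂ) (c : ℝ) (Q : Matrix (Fin nT) (Fin nT) ℂ) : ℝ :=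
  c * (Q.trace).re / rate H Rw Q

/-- Single-user feasible set `X_s`. -/
def Xs {nT nR : ℕ} (H : Matrix (Fin nR) (Fin nT) ℂ) (Rw : Matrix (Fin nR) (Fin nR) ℂ)
    (c w fT PT Tt : ℝ) : Set (Matrix (Fin nT) (Fin nT) ℂ × ℝ) :=
  {p | p.1.PosSemidef ∧ (p.1.trace).re ≤ PT ∧ 0 < p.2 ∧ p.2 ≤ fT ∧
    0 < rate H Rw p.1 ∧ c / rate H Rw p.1 + w / p.2 ≤ Tt}

namespace Matrix

theorem IsHermitian.det_one_add_smul {n : Type*} [Fintype n] [DecidableEq n] {M : Matrix n n ℂ}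
    (hM : M.IsHermitian) (t : ℝ) :
    (1 + t • M).det = ((∏ i, (1 + t * hM.eigenvalues i) : ℝ) : ℂ) := by
  have h : 1 + t • M = Unitary.conjStarAlgAut ℂ _ hM.eigenvectorUnitary
      (diagonal fun i => (1 + t * hM.eigenvalues i : ℂ)) := by
    have h1 : (diagonal fun i => (1 + t * hM.eigenvalues i : ℂ)) =
        1 + (t : ℂ) • diagonal (RCLike.ofReal ∘ hM.eigenvalues) := by
      rw [← diagonal_one, ← diagonal_smul, diagonal_add]
      rfl
    rw [h1, map_add, map_one, map_smul, ← hM.spectral_theorem]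
    rfl
  rw [h, Unitary.conjStarAlgAut_apply, det_mul_right_comm]
  simp

open scoped MatrixOrder in
theorem PosSemidef.exists_eq_conjTranspose_mul_self {n : Type*} [Fintype n] [DecidableEq n]
    {M : Matrix n n ℂ} (hM : M.PosSemidef) : ∃ B : Matrix n n ℂ, M = Bᴴ * B :=
  CStarAlgebra.nonneg_iff_eq_star_mul_self.mp hM.nonneg

end Matrix

section Rate

variable {nT nR : ℕ} {H : Matrix (Fin nR) (Fin nT) ℂ} {Rw : Matrix (Fin nR) (Fin nR) ℂ}
  {Q : Matrix (Fin nT) (Fin nT) ℂ}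

/-- Along the ray through a PSD covariance, the rate is a sum of parallel scalar channels. -/
theorem exists_rate_smul_eq_sum (hRw : Rw.PosDef) (hQ : Q.PosSemidef) :
    ∃ l : Fin nT → ℝ, (∀ i, 0 ≤ l i) ∧
      ∀ t : ℝ, 0 ≤ t → rate H Rw (t • Q) = ∑ i, Real.logb 2 (1 + t * l i) := by
  obtain ⟨B, rfl⟩ := hQ.exists_eq_conjTranspose_mul_self
  have hM : (B * (Hᴴ * Rw⁻¹ * H) * Bᴴ).PosSemidef :=
    (hRw.inv.posSemidef.conjTranspose_mul_mul_same H).mul_mul_conjTranspose_same B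
  refine ⟨hM.isHermitian.eigenvalues, hM.eigenvalues_nonneg, fun t ht => ?_⟩
  have hdet : (1 + Hᴴ * Rw⁻¹ * H * (t • (Bᴴ * B))).det =
      (1 + t • (B * (Hᴴ * Rw⁻¹ * H) * Bᴴ)).det := by
    rw [Matrix.mul_smul, ← Matrix.mul_assoc, ← Matrix.smul_mul, det_one_add_mul_comm,
      Matrix.mul_smul, ← Matrix.mul_assoc B]
  rw [rate, hdet, hM.isHermitian.det_one_add_smul, Complex.ofReal_re, Real.logb_prod]
  intro i _
  have := mul_nonneg ht (hM.eigenvalues_nonneg i)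
  positivity

theorem mul_logb_one_add_lt {s t : ℝ} (hs : 0 < s) (ht0 : 0 < t) (ht1 : t < 1) :
    t * Real.logb 2 (1 + s) < Real.logb 2 (1 + t * s) := by
  rw [← Real.logb_rpow_eq_mul_logb_of_pos (by positivity)]
  exact Real.logb_lt_logb one_lt_two (by positivity)
    (rpow_one_add_lt_one_add_mul_self (by linarith) hs.ne' ht0 ht1)

theorem mul_rate_lt_rate_smul (hRw : Rw.PosDef) (hQ : Q.PosSemidef) (hr : 0 < rate H Rw Q)
    {t : ℝ} (ht0 : 0 < t) (ht1 : t < 1) : t * rate H Rw Q < rate H Rw (t • Q) := by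
  obtain ⟨l, hl, hrate⟩ := exists_rate_smul_eq_sum (H := H) hRw hQ
  have h1 := hrate 1 zero_le_one
  simp only [one_smul, one_mul] at h1
  rw [h1] at hr
  rw [h1, hrate t ht0.le, Finset.mul_sum]
  refine Finset.sum_lt_sum (fun i _ => ?_) ?_
  · rcases (hl i).eq_or_lt with h | h
    · simp [← h]
    · exact (mul_logb_one_add_lt h ht0 ht1).le
  · obtain ⟨i, hi, hne⟩ := Finset.exists_ne_zero_of_sum_ne_zero hr.ne'
    refine ⟨i, hi, mul_logb_one_add_lt ((hl i).lt_of_ne fun h => hne ?_) ht0 ht1⟩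
    simp [← h]

theorem rate_zero : rate H Rw 0 = 0 := by simp [rate]

theorem exists_rate_smul_eq (hRw : Rw.PosDef) (hQ : Q.PosSemidef) {ρ : ℝ} (hρ : 0 < ρ)
    (hρQ : ρ ≤ rate H Rw Q) : ∃ t : ℝ, 0 < t ∧ t ≤ 1 ∧ rate H Rw (t • Q) = ρ := by
  obtain ⟨l, hl, hrate⟩ := exists_rate_smul_eq_sum (H := H) hRw hQ
  have hcont : ContinuousOn (fun t : ℝ => rate H Rw (t • Q)) (Set.Icc 0 1) := by
    refine ContinuousOn.congr (f := fun t : ℝ => ∑ i, Real.logb 2 (1 + t * l i)) ?_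
      fun t ht => hrate t ht.1
    refine continuousOn_finsetSum _ fun i _ => ?_
    refine ContinuousOn.div_const (ContinuousOn.log (by fun_prop) fun t ht => ?_) _
    have := mul_nonneg ht.1 (hl i)
    positivity
  obtain ⟨t, ht, h⟩ := intermediate_value_Icc zero_le_one hcont
    (show ρ ∈ Set.Icc _ _ by simpa [rate_zero] using ⟨hρ.le, hρQ⟩)
  refine ⟨t, ht.1.lt_of_ne ?_, ht.2, h⟩
  rintro rfl
  simp [rate_zero] at h
  exact hρ.ne h

theorem trace_re_nonneg (hQ : Q.PosSemidef) : 0 ≤ (Q.trace).re :=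
  (Complex.le_def.mp hQ.trace_nonneg).1

theorem trace_re_pos_of_rate_pos (hQ : Q.PosSemidef) (hr : 0 < rate H Rw Q) :
    0 < (Q.trace).re := by
  refine (trace_re_nonneg hQ).lt_of_ne fun h => ?_
  have hQ0 : Q = 0 := hQ.trace_eq_zero_iff.mp
    (Complex.ext h.symm (Complex.le_def.mp hQ.trace_nonneg).2.symm)
  simp [hQ0, rate_zero] at hr

theorem trace_smul_re (t : ℝ) : ((t • Q).trace).re = t * (Q.trace).re := by
  simp [Matrix.trace_smul]

/-- At the clock frequency `fT`, the latency constraint is the rate constraint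
`c / (Tt - w / fT) ≤ rate H Rw Q`. -/
theorem mem_Xs_of_rate_ge {c w fT PT Tt : ℝ} (hc : 0 < c) (hfT : 0 < fT) (hK : 0 < Tt - w / fT)
    (hQ : Q.PosSemidef) (hP : (Q.trace).re ≤ PT) (hr : c / (Tt - w / fT) ≤ rate H Rw Q) :
    (Q, fT) ∈ Xs H Rw c w fT PT Tt := by
  have hpos : 0 < rate H Rw Q := (div_pos hc hK).trans_le hr
  refine ⟨hQ, hP, hfT, le_rfl, hpos, ?_⟩
  have : c / rate H Rw Q ≤ Tt - w / fT := (div_le_comm₀ hK hpos).mp hr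
  simp only
  linarith

theorem div_rate_le_of_mem_Xs {c w f fT PT Tt : ℝ} (hw : 0 < w)
    (hp : (Q, f) ∈ Xs H Rw c w fT PT Tt) :
    c / rate H Rw Q ≤ Tt - w / fT := by
  obtain ⟨-, -, hf, hfle, -, h⟩ := hp
  have := div_le_div_of_nonneg_left hw.le hf hfle
  linarith

/-- A feasible point can be scaled down to a feasible point whose rate is the smallest allowed;
this lowers the power at least in proportion to the rate, strictly so if it changes the point. -/
theorem exists_smul_mem_Xs {c w f fT PT Tt : ℝ} (hRw : Rw.PosDef) (hc : 0 < c) (hw : 0 < w)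
    (hfT : 0 < fT) (hK : 0 < Tt - w / fT)
    (hp : (Q, f) ∈ Xs H Rw c w fT PT Tt) :
    ∃ t : ℝ, 0 < t ∧ (t • Q, fT) ∈ Xs H Rw c w fT PT Tt ∧
      rate H Rw (t • Q) = c / (Tt - w / fT) ∧
      t * rate H Rw Q ≤ c / (Tt - w / fT) ∧
      (c / (Tt - w / fT) = rate H Rw Q ∨ t < 1 ∧ t * rate H Rw Q < c / (Tt - w / fT)) := by
  have hle : c / (Tt - w / fT) ≤ rate H Rw Q :=
    (div_le_comm₀ hp.2.2.2.2.1 hK).mp (div_rate_le_of_mem_Xs hw hp)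
  obtain ⟨t, ht0, ht1, ht⟩ := exists_rate_smul_eq hRw hp.1 (div_pos hc hK) hle
  have hmem : (t • Q, fT) ∈ Xs H Rw c w fT PT Tt := by
    refine mem_Xs_of_rate_ge hc hfT hK (hp.1.smul ht0.le) ?_ ht.ge
    rw [trace_smul_re]
    exact (mul_le_of_le_one_left (trace_re_nonneg hp.1) ht1).trans hp.2.1
  refine ⟨t, ht0, hmem, ht, ?_⟩
  rcases ht1.eq_or_lt with rfl | ht1
  · rw [one_smul] at ht
    simp [ht]
  · have := mul_rate_lt_rate_smul hRw hp.1 hp.2.2.2.2.1 ht0 ht1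
    rw [ht] at this
    exact ⟨this.le, Or.inr ⟨ht1, this⟩⟩

end Rate

/-- Under `H ≠ 0` and strict feasibility, `(Q⋆, f⋆) ∈ X_s` globally minimizes the
energy `E` over `X_s` iff it globally minimizes the transmit power `tr(Q)` over `X_s`. -/
theorem energy_min_iff_power_min {nT nR : ℕ}
    (H : Matrix (Fin nR) (Fin nT) ℂ) (Rw : Matrix (Fin nR) (Fin nR) ℂ) (hRw : Rw.PosDef)
    (c w fT PT Tt rmax : ℝ) (hc : 0 < c) (hw : 0 < w) (hfT : 0 < fT) (hPT : 0 < PT)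
    (hH : H ≠ 0)
    (hrmax : IsGreatest (rate H Rw '' {Q | Q.PosSemidef ∧ (Q.trace).re ≤ PT}) rmax)
    (hstrict : c / rmax + w / fT < Tt)
    (Qstar : Matrix (Fin nT) (Fin nT) ℂ) (fstar : ℝ)
    (hfeas : (Qstar, fstar) ∈ Xs H Rw c w fT PT Tt) :
    (∀ p ∈ Xs H Rw c w fT PT Tt, energy H Rw c Qstar ≤ energy H Rw c p.1) ↔
    (∀ p ∈ Xs H Rw c w fT PT Tt, (Qstar.trace).re ≤ (p.1.trace).re) := by
  have hr : 0 < rate H Rw Qstar := hfeas.2.2.2.2.1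
  have htr : 0 < (Qstar.trace).re := trace_re_pos_of_rate_pos hfeas.1 hr
  have hK : 0 < Tt - w / fT := (div_pos hc hr).trans_le (div_rate_le_of_mem_Xs hw hfeas)
  have hρ : 0 < c / (Tt - w / fT) := div_pos hc hK
  obtain ⟨s, -, hs, hsr, -, hs1⟩ := exists_smul_mem_Xs hRw hc hw hfT hK hfeas
  constructor
  · rintro hE ⟨Q, f⟩ hp
    have htight : c / (Tt - w / fT) = rate H Rw Qstar := by
      refine hs1.resolve_right fun h => (hE _ hs).not_gt ?_
      simp only [energy, hsr, trace_smul_re]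
      rw [div_lt_div_iff₀ hρ hr]
      calc c * (s * (Qstar.trace).re) * rate H Rw Qstar
          = c * (Qstar.trace).re * (s * rate H Rw Qstar) := by ring
        _ < c * (Qstar.trace).re * (c / (Tt - w / fT)) :=
          mul_lt_mul_of_pos_left h.2 (mul_pos hc htr)
    have hp0 : 0 < rate H Rw Q := hp.2.2.2.2.1
    have hle : rate H Rw Qstar ≤ rate H Rw Q :=
      htight ▸ (div_le_comm₀ hp0 hK).mp (div_rate_le_of_mem_Xs hw hp)
    have h := (hE _ hp).trans (div_le_div_of_nonneg_left
      (mul_nonneg hc.le (trace_re_nonneg hp.1)) hr hle)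
    rw [energy, div_le_div_iff_of_pos_right hr] at h
    exact le_of_mul_le_mul_left h hc
  · rintro hP ⟨Q, f⟩ hp
    have htight : c / (Tt - w / fT) = rate H Rw Qstar := by
      refine hs1.resolve_right fun h => (hP _ hs).not_gt ?_
      simpa only [trace_smul_re] using mul_lt_of_lt_one_left htr h.1
    have hp0 : 0 < rate H Rw Q := hp.2.2.2.2.1
    obtain ⟨t, -, ht, -, htle, -⟩ := exists_smul_mem_Xs hRw hc hw hfT hK hp
    have h := hP _ ht
    simp only [trace_smul_re] at h
    rw [htight] at htle
    rw [energy, energy, div_le_div_iff₀ hr hp0, mul_assoc, mul_assoc]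
    refine mul_le_mul_of_nonneg_left ?_ hc.le
    calc (Qstar.trace).re * rate H Rw Q
        ≤ t * (Q.trace).re * rate H Rw Q := mul_le_mul_of_nonneg_right h hp0.le
      _ = (Q.trace).re * (t * rate H Rw Q) := by ring
      _ ≤ (Q.trace).re * rate H Rw Qstar :=
        mul_le_mul_of_nonneg_left htle (trace_re_nonneg hp.1)
end

section
/- Assume H ≠ 0 and strict feasibility, i.e., c/r^max + w/f_T < T̃, and set L := T̃ − w/f_T > 0. Then there is a unique α > 0 such that Σ_{i=1}^{ρ} log₂(max(α·d_i, 1)) = c/L, and for any such reduced eigendecomposition M = U·diag(d_1,…,d_ρ)·Uᴴ, the pair f★ = f_T, Q★ = U·diag((α − 1/d_1)⁺, …, (α − 1/d_ρ)⁺)·Uᴴ (where (x)⁺ := max(x, 0)) is the unique global minimizer of the energy E(Q) over X_s, and also the unique global minimizer of tr(Q) over X_s; in particular r(Q★) = c/L. -/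
open Matrix ComplexOrder

namespace Matrix

section LogDet

variable {n : Type*} [Fintype n] [DecidableEq n]

lemma IsHermitian.eq_one_of_eigenvalues_eq_one {B : Matrix n n ℂ} (hB : B.IsHermitian)
    (h : ∀ i, hB.eigenvalues i = 1) : B = 1 := by
  have hone : (RCLike.ofReal ∘ hB.eigenvalues : n → ℂ) = fun _ => 1 := by
    ext i; simp [h]
  rw [hB.spectral_theorem, hone, diagonal_one, map_one]

lemma IsHermitian.re_trace_eq {B : Matrix n n ℂ} (hB : B.IsHermitian) :
    B.trace.re = ∑ i, hB.eigenvalues i := by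
  simp [hB.trace_eq_sum_eigenvalues]

lemma PosDef.log_re_det_eq {B : Matrix n n ℂ} (hB : B.PosDef) :
    Real.log B.det.re = ∑ i, Real.log (hB.1.eigenvalues i) := by
  rw [hB.1.det_eq_prod_eigenvalues, ← Real.log_prod fun i _ => (hB.eigenvalues_pos i).ne']
  congr 1
  exact_mod_cast Complex.ofReal_re _

lemma PosDef.log_re_det_le {B : Matrix n n ℂ} (hB : B.PosDef) :
    Real.log B.det.re ≤ B.trace.re - Fintype.card n := by
  have h : ∑ i, Real.log (hB.1.eigenvalues i) ≤ ∑ i, (hB.1.eigenvalues i - 1) :=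
    Finset.sum_le_sum fun i _ => Real.log_le_sub_one_of_pos (hB.eigenvalues_pos i)
  rw [hB.log_re_det_eq, hB.1.re_trace_eq]
  simpa using h

lemma PosDef.eq_one_of_trace_le_log_re_det {B : Matrix n n ℂ} (hB : B.PosDef)
    (h : B.trace.re - Fintype.card n ≤ Real.log B.det.re) : B = 1 := by
  have hsum : ∑ i, Real.log (hB.1.eigenvalues i) = ∑ i, (hB.1.eigenvalues i - 1) := by
    have h' := hB.log_re_det_le
    rw [hB.log_re_det_eq, hB.1.re_trace_eq] at h h'
    simpa using le_antisymm h' h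
  rw [Finset.sum_eq_sum_iff_of_le
    fun i _ => Real.log_le_sub_one_of_pos (hB.eigenvalues_pos i)] at hsum
  refine hB.1.eq_one_of_eigenvalues_eq_one fun i => ?_
  by_contra hne
  exact (Real.log_lt_sub_one_of_pos (hB.eigenvalues_pos i) hne).ne (hsum i (Finset.mem_univ i))

section Scaling

variable {a : n → ℝ} {A : Matrix n n ℂ}

lemma PosDef.diagonal_mul_mul_diagonal (ha : ∀ i, 0 < a i) (hA : A.PosDef) :
    (diagonal (fun i => (a i : ℂ)) * A * diagonal (fun i => (a i : ℂ))).PosDef := by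
  have hH : (diagonal fun i => (a i : ℂ))ᴴ = diagonal fun i => (a i : ℂ) := by
    simp [diagonal_conjTranspose, Pi.star_def]
  have hinj : Function.Injective (diagonal fun i => (a i : ℂ)).mulVec := by
    refine mulVec_injective_of_isUnit ?_
    rw [isUnit_iff_isUnit_det, det_diagonal, isUnit_iff_ne_zero, Finset.prod_ne_zero_iff]
    exact fun i _ => by exact_mod_cast (ha i).ne'
  simpa only [hH] using hA.conjTranspose_mul_mul_same hinj

lemma re_trace_diagonal_mul_mul_diagonal :
    (diagonal (fun i => (a i : ℂ)) * A * diagonal (fun i => (a i : ℂ))).trace.re =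
      ∑ i, a i ^ 2 * (A i i).re := by
  simp only [trace, diag_apply, mul_diagonal, diagonal_mul, Complex.re_sum]
  refine Finset.sum_congr rfl fun i _ => ?_
  simp
  ring

lemma PosDef.log_re_det_diagonal_mul_mul_diagonal (ha : ∀ i, 0 < a i) (hA : A.PosDef) :
    Real.log (diagonal (fun i => (a i : ℂ)) * A * diagonal (fun i => (a i : ℂ))).det.re =
      ∑ i, Real.log (a i ^ 2) + Real.log A.det.re := by
  have hdet : (diagonal (fun i => (a i : ℂ)) * A * diagonal (fun i => (a i : ℂ))).det =
      ((∏ i, a i ^ 2 : ℝ) : ℂ) * A.det := by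
    simp only [det_mul, det_diagonal, Complex.ofReal_prod, Complex.ofReal_pow, Finset.prod_pow]
    ring
  have hpos : 0 < A.det.re := (Complex.pos_iff.mp hA.det_pos).1
  rw [hdet, Complex.re_ofReal_mul, Real.log_mul _ hpos.ne', Real.log_prod]
  · exact fun i _ => (pow_pos (ha i) 2).ne'
  · exact (Finset.prod_pos fun i _ => pow_pos (ha i) 2).ne'

/-- The tangent bound for `log det` at the positive diagonal matrix `diag(1 / a²)`. -/
lemma PosDef.log_re_det_le_of_diagonal (ha : ∀ i, 0 < a i) (hA : A.PosDef) :
    ∑ i, Real.log (a i ^ 2) + Real.log A.det.re ≤ ∑ i, (a i ^ 2 * (A i i).re - 1) := by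
  have h := (hA.diagonal_mul_mul_diagonal ha).log_re_det_le
  rw [hA.log_re_det_diagonal_mul_mul_diagonal ha, re_trace_diagonal_mul_mul_diagonal] at h
  simpa using h

lemma PosDef.eq_diagonal_of_le_log_re_det (ha : ∀ i, 0 < a i) (hA : A.PosDef)
    (h : ∑ i, (a i ^ 2 * (A i i).re - 1) ≤ ∑ i, Real.log (a i ^ 2) + Real.log A.det.re) :
    A = diagonal fun i => (((a i ^ 2)⁻¹ : ℝ) : ℂ) := by
  have hB := (hA.diagonal_mul_mul_diagonal ha).eq_one_of_trace_le_log_re_det (by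
    rw [hA.log_re_det_diagonal_mul_mul_diagonal ha, re_trace_diagonal_mul_mul_diagonal]
    simpa using h)
  ext i j
  have hij := congrFun (congrFun hB i) j
  have hi : (a i : ℂ) ≠ 0 := by exact_mod_cast (ha i).ne'
  have hj : (a j : ℂ) ≠ 0 := by exact_mod_cast (ha j).ne'
  rw [mul_diagonal, diagonal_mul] at hij
  rcases eq_or_ne i j with rfl | hne
  · rw [one_apply_eq] at hij
    rw [diagonal_apply_eq]
    push_cast
    field_simp
    linear_combination hij
  · rw [one_apply_ne hne] at hij
    rw [diagonal_apply_ne _ hne]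
    simpa [hi, hj] using hij

end Scaling

end LogDet

section Compression

variable {m n : Type*} [Fintype m] [Fintype n] [DecidableEq m] [DecidableEq n]
  {U : Matrix m n ℂ} {Q : Matrix m m ℂ}

lemma trace_compression_complement (hU : Uᴴ * U = 1) :
    ((1 - U * Uᴴ)ᴴ * Q * (1 - U * Uᴴ)).trace = Q.trace - (Uᴴ * Q * U).trace := by
  have hP : (1 - U * Uᴴ) * (1 - U * Uᴴ)ᴴ = 1 - U * Uᴴ := by
    have hUU : U * Uᴴ * (U * Uᴴ) = U * Uᴴ := by
      rw [Matrix.mul_assoc, ← Matrix.mul_assoc Uᴴ, hU, Matrix.one_mul]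
    simp [Matrix.mul_sub, Matrix.sub_mul, hUU]
  rw [trace_mul_comm, ← Matrix.mul_assoc, hP, Matrix.sub_mul, Matrix.one_mul, trace_sub,
    Matrix.mul_assoc, trace_mul_comm U]

lemma PosSemidef.re_trace_compression_le (hU : Uᴴ * U = 1) (hQ : Q.PosSemidef) :
    (Uᴴ * Q * U).trace.re ≤ Q.trace.re := by
  have h := (hQ.conjTranspose_mul_mul_same (1 - U * Uᴴ)).trace_nonneg
  rw [trace_compression_complement hU] at h
  simpa using (Complex.nonneg_iff.mp h).1

lemma PosSemidef.eq_of_re_trace_le_compression (hU : Uᴴ * U = 1) (hQ : Q.PosSemidef)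
    (h : Q.trace.re ≤ (Uᴴ * Q * U).trace.re) : Q = U * (Uᴴ * Q * U) * Uᴴ := by
  have hPQP := hQ.conjTranspose_mul_mul_same (1 - U * Uᴴ)
  have htr : ((1 - U * Uᴴ)ᴴ * Q * (1 - U * Uᴴ)).trace = 0 := by
    have h0 := hPQP.trace_nonneg
    have hre := congrArg Complex.re (trace_compression_complement (Q := Q) hU)
    rw [Complex.sub_re] at hre
    obtain ⟨h1, h2⟩ := Complex.nonneg_iff.mp h0
    exact Complex.ext (by simp only [Complex.zero_re]; linarith) h2.symm
  have hzero := hPQP.trace_eq_zero_iff.mp htr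
  have hQP : Q * (1 - U * Uᴴ) = 0 := by
    open scoped MatrixOrder in
    obtain ⟨B, rfl⟩ := CStarAlgebra.nonneg_iff_eq_star_mul_self.mp hQ.nonneg
    rw [star_eq_conjTranspose, ← Matrix.mul_assoc, ← conjTranspose_mul, Matrix.mul_assoc,
      conjTranspose_mul_self_eq_zero] at hzero
    rw [star_eq_conjTranspose, Matrix.mul_assoc, hzero, Matrix.mul_zero]
  have hr : Q = Q * (U * Uᴴ) := by
    simpa [Matrix.mul_sub, sub_eq_zero] using hQP
  have hl : Q = U * Uᴴ * Q := by
    simpa [hQ.1.eq] using congrArg (fun X : Matrix m m ℂ => Xᴴ) hr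
  calc Q = U * Uᴴ * Q := hl
    _ = U * Uᴴ * (Q * (U * Uᴴ)) := by rw [← hr]
    _ = U * (Uᴴ * Q * U) * Uᴴ := by simp only [Matrix.mul_assoc]

end Compression

end Matrix

section WaterLevel

variable {ρ : ℕ} {d : Fin ρ → ℝ}

lemma one_add_mul_waterfill {α x : ℝ} (hx : 0 < x) :
    1 + x * max (α - 1 / x) 0 = max (α * x) 1 := by
  rw [mul_max_of_nonneg _ _ hx.le, ← max_add_add_left]
  congr 1
  · field_simp; ring
  · ring

lemma existsUnique_water_level (hρ : 1 ≤ ρ) (hd : ∀ i, 0 < d i) {K : ℝ} (hK : 0 < K) :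
    ∃! α : ℝ, 0 < α ∧ ∑ i, Real.logb 2 (max (α * d i) 1) = K := by
  set g : ℝ → ℝ := fun α => ∑ i, Real.logb 2 (max (α * d i) 1)
  have hpos : ∀ (α : ℝ) i, 0 < max (α * d i) 1 := fun α i => lt_max_of_lt_right one_pos
  have hnonneg : ∀ (α : ℝ) i, 0 ≤ Real.logb 2 (max (α * d i) 1) := fun α i =>
    Real.logb_nonneg one_lt_two (le_max_right _ _)
  have hcont : Continuous g := by
    refine continuous_finsetSum _ fun i _ => ?_
    exact Continuous.div_const (Continuous.log (by fun_prop) fun α => (hpos α i).ne') _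
  have hlt : ∀ α β, α < β → g α = K → g β = K → False := by
    intro α β hαβ hα hβ
    obtain ⟨i, -, hi⟩ : ∃ i ∈ Finset.univ, 0 < Real.logb 2 (max (α * d i) 1) := by
      by_contra! h
      exact (hα ▸ hK).not_ge (Finset.sum_nonpos h)
    have hi1 : 1 < α * d i := by
      have := (Real.logb_pos_iff one_lt_two (hpos α i)).mp hi
      simpa using this
    refine absurd (hα.trans hβ.symm) (ne_of_lt (Finset.sum_lt_sum (fun j _ => ?_)
      ⟨i, Finset.mem_univ i, ?_⟩))
    · exact Real.logb_le_logb_of_le one_lt_two (hpos α j)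
        (max_le_max_right _ (mul_le_mul_of_nonneg_right hαβ.le (hd j).le))
    · refine Real.logb_lt_logb one_lt_two (hpos α i) ?_
      rw [max_eq_left hi1.le]
      exact lt_max_of_lt_left (mul_lt_mul_of_pos_right hαβ (hd i))
  have hex : ∃ α : ℝ, 0 < α ∧ g α = K := by
    let i₀ : Fin ρ := ⟨0, hρ⟩
    have hb : 0 ≤ (2 : ℝ) ^ K / d i₀ := by have := hd i₀; positivity
    have hg0 : g 0 = 0 := by simp [g]
    have hgb : K ≤ g (2 ^ K / d i₀) := by
      have hterm : Real.logb 2 (max (2 ^ K / d i₀ * d i₀) 1) = K := by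
        rw [div_mul_cancel₀ _ (hd i₀).ne', max_eq_left (Real.one_le_rpow one_le_two hK.le),
          Real.logb_rpow two_pos (by norm_num)]
      refine hterm.symm.trans_le ?_
      exact Finset.single_le_sum
        (f := fun i => Real.logb 2 (max (2 ^ K / d i₀ * d i) 1))
        (fun i _ => hnonneg _ i) (Finset.mem_univ i₀)
    obtain ⟨α, ⟨hα, -⟩, hgα⟩ := intermediate_value_Icc hb hcont.continuousOn
      (show K ∈ Set.Icc (g 0) _ from ⟨hg0.trans_le hK.le, hgb⟩)
    refine ⟨α, hα.lt_of_ne ?_, hgα⟩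
    rintro rfl
    exact hK.ne (hg0.symm.trans hgα)
  obtain ⟨α, hα, hgα⟩ := hex
  refine ⟨α, ⟨hα, hgα⟩, ?_⟩
  rintro β ⟨-, hβ⟩
  rcases lt_trichotomy β α with h | h | h
  · exact (hlt β α h hβ hgα).elim
  · exact h
  · exact (hlt α β h hgα hβ).elim

/-- The tangent bound underlying waterfilling, for parallel channels. -/
lemma log_det_one_add_diagonal_mul_le (hd : ∀ i, 0 < d i) {α : ℝ} (hα : 0 < α)
    {S : Matrix (Fin ρ) (Fin ρ) ℂ} (hS : S.PosSemidef) :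
    Real.log (1 + diagonal (fun i => (d i : ℂ)) * S).det.re ≤
        ∑ i, Real.log (max (α * d i) 1) + (S.trace.re - ∑ i, max (α - 1 / d i) 0) / α ∧
    (∑ i, Real.log (max (α * d i) 1) + (S.trace.re - ∑ i, max (α - 1 / d i) 0) / α ≤
        Real.log (1 + diagonal (fun i => (d i : ℂ)) * S).det.re →
      S = diagonal fun i => ((max (α - 1 / d i) 0 : ℝ) : ℂ)) := by
  set s : Fin ρ → ℝ := fun i => max (α - 1 / d i) 0
  set A : Matrix (Fin ρ) (Fin ρ) ℂ := diagonal (fun i => (((d i)⁻¹ : ℝ) : ℂ)) + S with hA_def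
  have hA : A.PosDef := by
    refine PosDef.add_posSemidef (posDef_diagonal_iff.mpr fun i => ?_) hS
    exact_mod_cast inv_pos.mpr (hd i)
  set a : Fin ρ → ℝ := fun i => Real.sqrt (d i / max (α * d i) 1)
  have hmax : ∀ i, 0 < max (α * d i) 1 := fun i => lt_max_of_lt_right one_pos
  have ha : ∀ i, 0 < a i := fun i => Real.sqrt_pos.mpr (div_pos (hd i) (hmax i))
  have ha2 : ∀ i, a i ^ 2 = d i / max (α * d i) 1 := fun i =>
    Real.sq_sqrt (div_pos (hd i) (hmax i)).le
  have hlog : Real.log (1 + diagonal (fun i => (d i : ℂ)) * S).det.re =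
      ∑ i, Real.log (max (α * d i) 1) + (∑ i, Real.log (a i ^ 2) + Real.log A.det.re) := by
    have hfac : 1 + diagonal (fun i => (d i : ℂ)) * S = diagonal (fun i => (d i : ℂ)) * A := by
      rw [hA_def, Matrix.mul_add, diagonal_mul_diagonal]
      congr 1
      rw [← diagonal_one]
      congr 1
      ext i
      have : (d i : ℂ) ≠ 0 := by exact_mod_cast (hd i).ne'
      simp [this]
    have hdet : (1 + diagonal (fun i => (d i : ℂ)) * S).det = ((∏ i, d i : ℝ) : ℂ) * A.det := by
      rw [hfac, det_mul, det_diagonal, Complex.ofReal_prod]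
    have hApos : 0 < A.det.re := (Complex.pos_iff.mp hA.det_pos).1
    rw [hdet, Complex.re_ofReal_mul, Real.log_mul (Finset.prod_pos fun i _ => hd i).ne' hApos.ne',
      Real.log_prod fun i _ => (hd i).ne', ← add_assoc, ← Finset.sum_add_distrib]
    congr 1
    refine Finset.sum_congr rfl fun i _ => ?_
    rw [ha2, Real.log_div (hd i).ne' (hmax i).ne']
    ring
  have hterm : ∀ i, a i ^ 2 * (A i i).re - 1 ≤ ((S i i).re - s i) / α := by
    intro i
    have hSi : 0 ≤ (S i i).re := (Complex.nonneg_iff.mp hS.diag_nonneg).1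
    have hAi : (A i i).re = (d i)⁻¹ + (S i i).re := by
      rw [hA_def, Matrix.add_apply, diagonal_apply_eq, Complex.add_re, Complex.ofReal_re]
    have hdi := hd i
    rw [hAi, ha2]
    rcases le_total 1 (α * d i) with h | h
    · have hs : s i = α - 1 / d i := max_eq_left (by rw [sub_nonneg, div_le_iff₀ hdi]; exact h)
      rw [max_eq_left h, hs]
      apply le_of_eq
      field_simp
      ring
    · have hs : s i = 0 := max_eq_right (by rw [sub_nonpos, le_div_iff₀ hdi]; exact h)
      rw [max_eq_right h, hs, sub_zero, div_one, mul_add, mul_inv_cancel₀ hdi.ne',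
        add_sub_cancel_left, le_div_iff₀ hα]
      nlinarith
  have hsum : ∑ i, (a i ^ 2 * (A i i).re - 1) ≤ (S.trace.re - ∑ i, s i) / α := by
    refine (Finset.sum_le_sum fun i _ => hterm i).trans_eq ?_
    rw [← Finset.sum_div, Finset.sum_sub_distrib]
    simp [trace]
  have hbound := hA.log_re_det_le_of_diagonal ha
  rw [hlog]
  refine ⟨by linarith, fun h => ?_⟩
  have hAeq := hA.eq_diagonal_of_le_log_re_det ha (by linarith)
  rw [hA_def, ← eq_sub_iff_add_eq', diagonal_sub] at hAeq
  rw [hAeq]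
  congr 1
  ext i
  rw [ha2, ← Complex.ofReal_sub, ← one_add_mul_waterfill (hd i)]
  have := (hd i).ne'
  congr 1
  field_simp
  ring

end WaterLevel

section Rate

variable {nT nR ρ : ℕ} {H : Matrix (Fin nR) (Fin nT) ℂ} {Rw : Matrix (Fin nR) (Fin nR) ℂ}
  {d : Fin ρ → ℝ} {U : Matrix (Fin nT) (Fin ρ) ℂ}

lemma rate_eq_logb_det_compression
    (hdec : Hᴴ * Rw⁻¹ * H = U * diagonal (fun i => (d i : ℂ)) * Uᴴ)
    (Q : Matrix (Fin nT) (Fin nT) ℂ) :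
    rate H Rw Q = Real.logb 2 (1 + diagonal (fun i => (d i : ℂ)) * (Uᴴ * Q * U)).det.re := by
  have h : U * diagonal (fun i => (d i : ℂ)) * Uᴴ * Q =
      U * (diagonal (fun i => (d i : ℂ)) * Uᴴ * Q) := by
    simp only [Matrix.mul_assoc]
  rw [rate, hdec, h, det_one_add_mul_comm]
  simp only [Matrix.mul_assoc]

lemma compression_expansion (hU : Uᴴ * U = 1) (S : Matrix (Fin ρ) (Fin ρ) ℂ) :
    Uᴴ * (U * S * Uᴴ) * U = S := by
  calc Uᴴ * (U * S * Uᴴ) * U = (Uᴴ * U) * S * (Uᴴ * U) := by simp only [Matrix.mul_assoc]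
    _ = S := by rw [hU, Matrix.one_mul, Matrix.mul_one]

lemma rate_expansion_diagonal (hU : Uᴴ * U = 1)
    (hdec : Hᴴ * Rw⁻¹ * H = U * diagonal (fun i => (d i : ℂ)) * Uᴴ)
    (hd : ∀ i, 0 < d i) {s : Fin ρ → ℝ} (hs : ∀ i, 0 ≤ s i) :
    rate H Rw (U * diagonal (fun i => (s i : ℂ)) * Uᴴ) =
      ∑ i, Real.logb 2 (1 + d i * s i) := by
  have hdet : (1 + diagonal (fun i => (d i : ℂ)) * diagonal fun i => (s i : ℂ)).det =
      ((∏ i, (1 + d i * s i) : ℝ) : ℂ) := by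
    rw [diagonal_mul_diagonal, ← diagonal_one, diagonal_add, det_diagonal]
    push_cast
    rfl
  rw [rate_eq_logb_det_compression hdec, compression_expansion hU, hdet, Complex.ofReal_re,
    Real.logb_prod]
  intro i _
  have := mul_nonneg (hd i).le (hs i)
  positivity

lemma trace_expansion (hU : Uᴴ * U = 1) (S : Matrix (Fin ρ) (Fin ρ) ℂ) :
    (U * S * Uᴴ).trace = S.trace := by
  rw [trace_mul_comm, ← Matrix.mul_assoc, hU, Matrix.one_mul]

lemma posSemidef_expansion_diagonal {s : Fin ρ → ℝ} (hs : ∀ i, 0 ≤ s i) :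
    (U * diagonal (fun i => (s i : ℂ)) * Uᴴ).PosSemidef :=
  (posSemidef_diagonal_iff.mpr fun i => by exact_mod_cast hs i).mul_mul_conjTranspose_same U

lemma exists_rate_pos (hρ : 1 ≤ ρ) (hd : ∀ i, 0 < d i) (hU : Uᴴ * U = 1)
    (hdec : Hᴴ * Rw⁻¹ * H = U * diagonal (fun i => (d i : ℂ)) * Uᴴ)
    {P : ℝ} (hP : 0 < P) :
    ∃ Q : Matrix (Fin nT) (Fin nT) ℂ, Q.PosSemidef ∧ Q.trace.re ≤ P ∧ 0 < rate H Rw Q := by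
  have hρ' : (0 : ℝ) < ρ := by exact_mod_cast hρ
  have hs : 0 < P / ρ := div_pos hP hρ'
  refine ⟨U * diagonal (fun _ => ((P / ρ : ℝ) : ℂ)) * Uᴴ,
    posSemidef_expansion_diagonal fun _ => hs.le, ?_, ?_⟩
  · rw [trace_expansion hU, trace_diagonal, ← Complex.ofReal_sum, Complex.ofReal_re]
    simp [mul_div_cancel₀ P hρ'.ne']
  · rw [rate_expansion_diagonal hU hdec hd fun _ => hs.le]
    refine Finset.sum_pos (fun i _ => Real.logb_pos one_lt_two ?_) ⟨⟨0, hρ⟩, Finset.mem_univ _⟩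
    linarith [mul_pos (hd i) hs]

/-- The rate is dominated by its tangent at the waterfilling covariance, strictly elsewhere. -/
lemma rate_le_tangent (hd : ∀ i, 0 < d i) (hU : Uᴴ * U = 1)
    (hdec : Hᴴ * Rw⁻¹ * H = U * diagonal (fun i => (d i : ℂ)) * Uᴴ)
    {α : ℝ} (hα : 0 < α) {Qstar : Matrix (Fin nT) (Fin nT) ℂ}
    (hQstar : Qstar = U * diagonal (fun i => ((max (α - 1 / d i) 0 : ℝ) : ℂ)) * Uᴴ)
    {Q : Matrix (Fin nT) (Fin nT) ℂ} (hQ : Q.PosSemidef) :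
    α * Real.log 2 * (rate H Rw Q - rate H Rw Qstar) ≤ Q.trace.re - Qstar.trace.re ∧
    (Q.trace.re - Qstar.trace.re ≤ α * Real.log 2 * (rate H Rw Q - rate H Rw Qstar) →
      Q = Qstar) := by
  have hlog2 : Real.log 2 ≠ 0 := (Real.log_pos one_lt_two).ne'
  have hrate : Real.log 2 * rate H Rw Q =
      Real.log (1 + diagonal (fun i => (d i : ℂ)) * (Uᴴ * Q * U)).det.re := by
    rw [rate_eq_logb_det_compression hdec, Real.logb, mul_div_cancel₀ _ hlog2]
  have hrate' : Real.log 2 * rate H Rw Qstar = ∑ i, Real.log (max (α * d i) 1) := by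
    rw [hQstar, rate_expansion_diagonal hU hdec hd fun i => le_max_right _ _, Finset.mul_sum]
    refine Finset.sum_congr rfl fun i _ => ?_
    rw [one_add_mul_waterfill (hd i), Real.logb, mul_div_cancel₀ _ hlog2]
  have htr : Qstar.trace.re = ∑ i, max (α - 1 / d i) 0 := by
    rw [hQstar, trace_expansion hU, trace_diagonal, ← Complex.ofReal_sum, Complex.ofReal_re]
  obtain ⟨hle, heq⟩ :=
    log_det_one_add_diagonal_mul_le hd hα (hQ.conjTranspose_mul_mul_same U)
  have hcomp := hQ.re_trace_compression_le hU
  rw [← hrate, ← hrate', ← htr] at hle heq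
  have hcancel : ∀ x : ℝ, α * (x / α) = x := fun x => mul_div_cancel₀ x hα.ne'
  have hle' := mul_le_mul_of_nonneg_left hle hα.le
  rw [mul_add, hcancel] at hle'
  refine ⟨by linarith, fun h => ?_⟩
  have hS := heq (by
    refine le_of_mul_le_mul_left ?_ hα
    rw [mul_add, hcancel]
    linarith)
  rw [hQ.eq_of_re_trace_le_compression hU (by linarith), hS, hQstar]

end Rate

/-- Closed-form waterfilling-like solution of the single-user offloading problem:
under strict feasibility there is a unique water level `α > 0` such that
`Σᵢ log₂(max(α dᵢ, 1)) = c/L` with `L = T̃ - w/f_T`, and for any reduced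
eigendecomposition `Hᴴ R_w⁻¹ H = U diag(d) Uᴴ`, the pair
`(Q⋆, f_T)` with `Q⋆ = U diag((α - 1/dᵢ)⁺) Uᴴ` is the unique global minimizer of the
energy over `X_s` and of the transmit power over `X_s`, and `r(Q⋆) = c/L`. -/
theorem waterfilling_unique_global_min {nT nR : ℕ}
    (H : Matrix (Fin nR) (Fin nT) ℂ) (Rw : Matrix (Fin nR) (Fin nR) ℂ) (hRw : Rw.PosDef)
    (c w fT PT Tt rmax : ℝ) (hc : 0 < c) (hw : 0 < w) (hfT : 0 < fT) (hPT : 0 < PT)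
    (hH : H ≠ 0)
    (hrmax : IsGreatest (rate H Rw '' {Q | Q.PosSemidef ∧ (Q.trace).re ≤ PT}) rmax)
    (hstrict : c / rmax + w / fT < Tt)
    (ρ : ℕ) (hρ : 1 ≤ ρ) (d : Fin ρ → ℝ) (hd : ∀ i, 0 < d i) (hmono : Antitone d)
    (U : Matrix (Fin nT) (Fin ρ) ℂ) (hU : Uᴴ * U = 1)
    (hrank : (Hᴴ * Rw⁻¹ * H).rank = ρ)
    (hdec : Hᴴ * Rw⁻¹ * H = U * Matrix.diagonal (fun i => (d i : ℂ)) * Uᴴ) :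
    (∃! α : ℝ, 0 < α ∧
        (∑ i, Real.logb 2 (max (α * d i) 1)) = c / (Tt - w / fT)) ∧
    (∀ α : ℝ, 0 < α →
      (∑ i, Real.logb 2 (max (α * d i) 1)) = c / (Tt - w / fT) →
      ∀ Qstar : Matrix (Fin nT) (Fin nT) ℂ,
        Qstar = U * Matrix.diagonal (fun i => ((max (α - 1 / d i) 0 : ℝ) : ℂ)) * Uᴴ →
        (Qstar, fT) ∈ Xs H Rw c w fT PT Tt ∧
        rate H Rw Qstar = c / (Tt - w / fT) ∧
        (∀ p ∈ Xs H Rw c w fT PT Tt, energy H Rw c Qstar ≤ energy H Rw c p.1) ∧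
        (∀ p ∈ Xs H Rw c w fT PT Tt,
          (∀ q ∈ Xs H Rw c w fT PT Tt, energy H Rw c p.1 ≤ energy H Rw c q.1) →
          p = (Qstar, fT)) ∧
        (∀ p ∈ Xs H Rw c w fT PT Tt, (Qstar.trace).re ≤ (p.1.trace).re) ∧
        (∀ p ∈ Xs H Rw c w fT PT Tt,
          (∀ q ∈ Xs H Rw c w fT PT Tt, (p.1.trace).re ≤ (q.1.trace).re) →
          p = (Qstar, fT))) := by
  have hrmax_pos : 0 < rmax := by
    obtain ⟨Q, hQ, hQtr, hQr⟩ := exists_rate_pos hρ hd hU hdec hPT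
    exact hQr.trans_le (hrmax.2 ⟨Q, ⟨hQ, hQtr⟩, rfl⟩)
  set L := Tt - w / fT with hL_def
  have hcr : c / rmax < L := by linarith
  have hL : 0 < L := (div_pos hc hrmax_pos).trans hcr
  have hK : 0 < c / L := div_pos hc hL
  refine ⟨existsUnique_water_level hρ hd hK, fun α hα hlevel Qstar hQstar => ?_⟩
  have hpsd : Qstar.PosSemidef := by
    rw [hQstar]; exact posSemidef_expansion_diagonal fun i => le_max_right _ _
  have hrate : rate H Rw Qstar = c / L := by
    rw [hQstar, rate_expansion_diagonal hU hdec hd fun i => le_max_right _ _, ← hlevel]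
    exact Finset.sum_congr rfl fun i _ => by rw [one_add_mul_waterfill (hd i)]
  have htangent : ∀ Q : Matrix (Fin nT) (Fin nT) ℂ, Q.PosSemidef → _ := fun Q hQ =>
    rate_le_tangent (Q := Q) hd hU hdec hα hQstar hQ
  set β := α * Real.log 2
  have hβ : 0 < β := mul_pos hα (Real.log_pos one_lt_two)
  rw [hrate] at htangent
  have hfeas_rate : ∀ p ∈ Xs H Rw c w fT PT Tt, c / L ≤ rate H Rw p.1 := by
    rintro p ⟨-, -, hf, hfle, hr, hlat⟩
    have hwf : w / fT ≤ w / p.2 := div_le_div_of_nonneg_left hw.le hf hfle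
    have hcL : c / rate H Rw p.1 ≤ L := by linarith
    rw [div_le_iff₀ hr] at hcL
    rw [div_le_iff₀ hL]
    linarith
  have hfreq : ∀ p ∈ Xs H Rw c w fT PT Tt, p.1 = Qstar → p = (Qstar, fT) := by
    rintro p ⟨-, -, hf, hfle, -, hlat⟩ hp
    rw [hp, hrate, div_div_cancel₀ hc.ne'] at hlat
    have hwf : w / p.2 ≤ w / fT := by linarith
    exact Prod.ext hp (le_antisymm hfle ((div_le_div_iff_of_pos_left hw hf hfT).mp hwf))
  have hmem : (Qstar, fT) ∈ Xs H Rw c w fT PT Tt := by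
    refine ⟨hpsd, ?_, hfT, le_rfl, hrate ▸ hK, ?_⟩
    · obtain ⟨Q, ⟨hQ, hQtr⟩, hQr⟩ := hrmax.1
      have hle : c / L ≤ rate H Rw Q := by
        rw [hQr, div_le_iff₀ hL]
        rw [div_lt_iff₀ hrmax_pos] at hcr
        linarith
      have := (htangent Q hQ).1
      have := mul_nonneg hβ.le (sub_nonneg.mpr hle)
      simp only
      linarith
    · simp only [hrate, div_div_cancel₀ hc.ne']
      linarith
  have htr_le : ∀ p ∈ Xs H Rw c w fT PT Tt, Qstar.trace.re ≤ p.1.trace.re := fun p hp => by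
    have := (htangent p.1 hp.1).1
    have := mul_nonneg hβ.le (sub_nonneg.mpr (hfeas_rate p hp))
    linarith
  have hzero : Qstar.trace.re ≤ β * (c / L) := by
    have h := (htangent 0 PosSemidef.zero).1
    have h0 : rate H Rw 0 = 0 := by simp [rate]
    rw [h0] at h
    simp only [trace_zero, Complex.zero_re] at h
    linarith
  have henergy : ∀ p ∈ Xs H Rw c w fT PT Tt,
      (energy H Rw c Qstar ≤ energy H Rw c p.1 ∧
        (energy H Rw c p.1 ≤ energy H Rw c Qstar → p.1 = Qstar)) := by
    intro p hp
    have hr : 0 < rate H Rw p.1 := hp.2.2.2.2.1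
    obtain ⟨h1, h2⟩ := htangent p.1 hp.1
    have hgap := mul_nonneg (sub_nonneg.mpr (hfeas_rate p hp)) (sub_nonneg.mpr hzero)
    simp only [energy, hrate]
    constructor
    · rw [div_le_div_iff₀ hK hr, mul_assoc, mul_assoc]
      refine mul_le_mul_of_nonneg_left ?_ hc.le
      nlinarith [mul_le_mul_of_nonneg_right h1 hK.le]
    · intro h
      rw [div_le_div_iff₀ hr hK, mul_assoc, mul_assoc] at h
      have h' := le_of_mul_le_mul_left h hc
      refine h2 (le_of_mul_le_mul_right ?_ hK)
      nlinarith
  refine ⟨hmem, hrate, fun p hp => (henergy p hp).1, fun p hp hmin => ?_, htr_le,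
    fun p hp hmin => ?_⟩
  · exact hfreq p hp ((henergy p hp).2 (hmin _ hmem))
  · refine hfreq p hp ((htangent p.1 hp.1).2 ?_)
    have := mul_nonneg hβ.le (sub_nonneg.mpr (hfeas_rate p hp))
    have := hmin _ hmem
    simp only at this
    linarith
end

section
/- Assume H ≠ 0 (so that r^max > 0). Then the feasible set X_s is nonempty if and only if c/r^max + w/f_T ≤ T̃. -/
open Matrix ComplexOrder

/-- Transmitting along a direction not annihilated by the channel gives a positive rate. -/
theorem rate_smul_vecMulVec_pos {nT nR : ℕ} {H : Matrix (Fin nR) (Fin nT) ℂ}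
    {Rw : Matrix (Fin nR) (Fin nR) ℂ} (hRw : Rw.PosDef) {v : Fin nT → ℂ} (hv : H *ᵥ v ≠ 0)
    {t : ℝ} (ht : 0 < t) : 0 < rate H Rw (t • vecMulVec v (star v)) := by
  have hpos : 0 < star v ⬝ᵥ ((Hᴴ * Rw⁻¹ * H) *ᵥ v) := by
    have h := hRw.inv.dotProduct_mulVec_pos hv
    rwa [star_mulVec, ← dotProduct_mulVec, mulVec_mulVec, mulVec_mulVec] at h
  have hdet : (1 + Hᴴ * Rw⁻¹ * H * (t • vecMulVec v (star v))).det =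
      1 + t • (star v ⬝ᵥ ((Hᴴ * Rw⁻¹ * H) *ᵥ v)) := by
    rw [Matrix.mul_smul, mul_vecMulVec, ← smul_vecMulVec, vecMulVec_eq Unit,
      det_one_add_replicateCol_mul_replicateRow, dotProduct_smul]
  rw [rate, hdet]
  refine Real.logb_pos one_lt_two ?_
  simpa using mul_pos ht (Complex.pos_iff.mp hpos).1

/-- Offloading feasibility: under `H ≠ 0`, the feasible set `X_s` is nonempty iff
`c/r^max + w/f_T ≤ T̃`. -/
theorem feasibility_iff {nT nR : ℕ}
    (H : Matrix (Fin nR) (Fin nT) ℂ) (Rw : Matrix (Fin nR) (Fin nR) ℂ) (hRw : Rw.PosDef)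
    (c w fT PT Tt rmax : ℝ) (hc : 0 < c) (hw : 0 < w) (hfT : 0 < fT) (hPT : 0 < PT)
    (hH : H ≠ 0)
    (hrmax : IsGreatest (rate H Rw '' {Q | Q.PosSemidef ∧ (Q.trace).re ≤ PT}) rmax) :
    (Xs H Rw c w fT PT Tt).Nonempty ↔ c / rmax + w / fT ≤ Tt := by
  have hmax : 0 < rmax := by
    obtain ⟨i, j, hij⟩ : ∃ i j, H i j ≠ 0 := by
      by_contra! h
      exact hH (Matrix.ext h)
    have hv : H *ᵥ Pi.single j 1 ≠ 0 := fun h => hij (by simpa using congrFun h i)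
    refine (rate_smul_vecMulVec_pos hRw hv hPT).trans_le (hrmax.2 ⟨_, ⟨?_, ?_⟩, rfl⟩)
    · exact (posSemidef_vecMulVec_self_star _).smul hPT.le
    · simp [trace_smul, trace_vecMulVec]
  constructor
  · rintro ⟨⟨Q, f⟩, hQ, htr, hf, hff, hr, hle⟩
    have hle' : rate H Rw Q ≤ rmax := hrmax.2 ⟨Q, ⟨hQ, htr⟩, rfl⟩
    refine le_trans ?_ hle
    dsimp only at *
    gcongr
  · intro h
    obtain ⟨Q, ⟨hQ, htr⟩, rfl⟩ := hrmax.1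
    exact ⟨(Q, fT), hQ, htr, hfT, le_rfl, hmax, h⟩
end

section
/- Assume H ≠ 0 and that the feasibility condition holds with equality: c/r^max + w/f_T = T̃. Then the feasible set is exactly X_s = { (Q, f_T) : Q Hermitian PSD, tr(Q) ≤ P_T, r(Q) = r^max }; that is, at every feasible point the wireless resources achieve the maximum rate r^max and the full computational budget f = f_T is used. -/
open Matrix ComplexOrder

/-- Some input covariance of trace `P > 0` achieves a positive rate over a nonzero channel. -/
theorem exists_rate_pos_s4 {nT nR : ℕ} {H : Matrix (Fin nR) (Fin nT) ℂ}
    {Rw : Matrix (Fin nR) (Fin nR) ℂ} (hRw : Rw.PosDef) (hH : H ≠ 0) {P : ℝ} (hP : 0 < P) :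
    ∃ Q : Matrix (Fin nT) (Fin nT) ℂ,
      Q.PosSemidef ∧ Q.trace.re = P ∧ 0 < rate H Rw Q := by
  obtain ⟨j, hj⟩ : ∃ j, H *ᵥ Pi.single j 1 ≠ 0 := by
    by_contra! h
    refine hH (Matrix.ext fun i j => ?_)
    simpa using congrFun (h j) i
  set v : Fin nT → ℂ := Pi.single j 1 with hv
  have hquad : 0 < star (H *ᵥ v) ⬝ᵥ (Rw⁻¹ *ᵥ (H *ᵥ v)) := hRw.inv.dotProduct_mulVec_pos hj
  have hP' : (0 : ℂ) < P := by exact_mod_cast hP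
  have hdet : (1 + Hᴴ * Rw⁻¹ * H * ((P : ℂ) • vecMulVec v (star v))).det =
      1 + P * (star (H *ᵥ v) ⬝ᵥ (Rw⁻¹ *ᵥ (H *ᵥ v))) := by
    rw [← smul_vecMulVec, mul_vecMulVec, vecMulVec_eq Unit,
      det_one_add_replicateCol_mul_replicateRow, mulVec_smul, dotProduct_smul, smul_eq_mul,
      star_mulVec, ← dotProduct_mulVec, mulVec_mulVec, mulVec_mulVec, Matrix.mul_assoc]
  refine ⟨(P : ℂ) • vecMulVec v (star v), (posSemidef_vecMulVec_self_star v).smul hP'.le, ?_, ?_⟩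
  · simp [trace_smul, trace_vecMulVec, hv]
  · refine Real.logb_pos one_lt_two ?_
    rw [hdet]
    have := (Complex.lt_def.1 (mul_pos hP' hquad)).1
    simpa using this

/-- When the feasibility condition holds with equality, `c/r^max + w/f_T = T̃`, the
feasible set reduces to the points using full resources: maximum rate `r(Q) = r^max`
and full computational budget `f = f_T`. -/
theorem feasible_set_at_equality {nT nR : ℕ}
    (H : Matrix (Fin nR) (Fin nT) ℂ) (Rw : Matrix (Fin nR) (Fin nR) ℂ) (hRw : Rw.PosDef)
    (c w fT PT Tt rmax : ℝ) (hc : 0 < c) (hw : 0 < w) (hfT : 0 < fT) (hPT : 0 < PT)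
    (hH : H ≠ 0)
    (hrmax : IsGreatest (rate H Rw '' {Q | Q.PosSemidef ∧ (Q.trace).re ≤ PT}) rmax)
    (heq : c / rmax + w / fT = Tt) :
    Xs H Rw c w fT PT Tt =
      {p : Matrix (Fin nT) (Fin nT) ℂ × ℝ |
        p.1.PosSemidef ∧ (p.1.trace).re ≤ PT ∧ rate H Rw p.1 = rmax ∧ p.2 = fT} := by
  have hrpos : 0 < rmax := by
    obtain ⟨Q, hQ, htr, hpos⟩ := exists_rate_pos_s4 hRw hH hPT
    exact hpos.trans_le (hrmax.2 ⟨Q, ⟨hQ, htr.le⟩, rfl⟩)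
  ext ⟨Q, f⟩
  constructor
  · rintro ⟨hQ, htr, hf, hfle, hr, hle⟩
    dsimp only at hQ htr hf hfle hr hle
    have hrle : rate H Rw Q ≤ rmax := hrmax.2 ⟨Q, ⟨hQ, htr⟩, rfl⟩
    have h₁ : c / rmax ≤ c / rate H Rw Q := by gcongr
    have h₂ : w / fT ≤ w / f := by gcongr
    refine ⟨hQ, htr, hrle.antisymm ?_, hfle.antisymm ?_⟩
    · exact (div_le_div_iff_of_pos_left hc hr hrpos).1 (by linarith)
    · exact (div_le_div_iff_of_pos_left hw hf hfT).1 (by linarith)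
  · rintro ⟨hQ, htr, hr, hf⟩
    dsimp only at hQ htr hr hf
    subst hf
    exact ⟨hQ, htr, hfT, le_rfl, hr ▸ hrpos, hr ▸ heq.le⟩
end

section
/- Let Q, Y ∈ ℂ^{n_T×n_T} be Hermitian PSD with r(Q) > 0 and r(Y) > 0, and define the gradient matrix G(Y) := (c/r(Y)²)·( r(Y)·I_{n_T} − (tr(Y)/ln 2)·Hᴴ (R_w + H Y Hᴴ)⁻¹ H ). If E(Q) < E(Y), then Re tr( G(Y)·(Q − Y) ) < 0. (Pseudo-convexity of the energy function E on the PSD cone where the rate is positive.) -/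
open Matrix ComplexOrder

/-- Conjugate gradient of the energy:
`G(Y) = (c/r(Y)²)·( r(Y)·I − (tr(Y)/ln 2)·Hᴴ (R_w + H Y Hᴴ)⁻¹ H )`. -/
noncomputable def gradE {nT nR : ℕ} (H : Matrix (Fin nR) (Fin nT) ℂ)
    (Rw : Matrix (Fin nR) (Fin nR) ℂ) (c : ℝ) (Y : Matrix (Fin nT) (Fin nT) ℂ) :
    Matrix (Fin nT) (Fin nT) ℂ :=
  (c / (rate H Rw Y) ^ 2) •
    (rate H Rw Y • (1 : Matrix (Fin nT) (Fin nT) ℂ)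
      - ((Y.trace).re / Real.log 2) • (Hᴴ * (Rw + H * Y * Hᴴ)⁻¹ * H))

namespace Matrix

variable {n : Type*} [Fintype n] [DecidableEq n]

/-- `log det M ≤ tr M - n` for positive definite `M`. -/
lemma PosDef.log_re_det_le_s6 {M : Matrix n n ℂ} (hM : M.PosDef) :
    Real.log M.det.re ≤ M.trace.re - Fintype.card n := by
  rw [hM.isHermitian.det_eq_prod_eigenvalues, hM.isHermitian.trace_eq_sum_eigenvalues]
  simp only [Complex.coe_algebraMap, ← RCLike.algebraMap_eq_ofReal, ← Complex.ofReal_prod,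
    ← Complex.ofReal_sum, Complex.ofReal_re]
  rw [Real.log_prod fun i _ ↦ (hM.eigenvalues_pos i).ne']
  calc ∑ i, Real.log (hM.isHermitian.eigenvalues i)
      ≤ ∑ i, (hM.isHermitian.eigenvalues i - 1) :=
        Finset.sum_le_sum fun i _ ↦ Real.log_le_sub_one_of_pos (hM.eigenvalues_pos i)
    _ = _ := by simp

lemma PosDef.re_det_pos {M : Matrix n n ℂ} (hM : M.PosDef) : 0 < M.det.re :=
  (Complex.pos_iff.1 hM.det_pos).1

/-- The determinant of a positive definite complex matrix is real. -/
lemma PosDef.det_eq_ofReal {M : Matrix n n ℂ} (hM : M.PosDef) : M.det = (M.det.re : ℂ) :=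
  Complex.ext (by simp) (by simpa using (Complex.pos_iff.1 hM.det_pos).2.symm)

open scoped MatrixOrder in
/-- Gradient inequality for the concave function `log det` at `A`. -/
lemma PosDef.log_re_det_sub_le {A B : Matrix n n ℂ} (hA : A.PosDef) (hB : B.PosDef) :
    Real.log B.det.re - Real.log A.det.re ≤ (A⁻¹ * (B - A)).trace.re := by
  have hAu : IsUnit A.det := hA.det_pos.ne'.isUnit
  obtain ⟨C, hC⟩ := CStarAlgebra.nonneg_iff_eq_star_mul_self.mp hA.inv.posSemidef.nonneg
  rw [star_eq_conjTranspose] at hC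
  have hdet : (C * B * Cᴴ).det = ((B.det.re / A.det.re : ℝ) : ℂ) := by
    have : (C * B * Cᴴ).det = A⁻¹.det * B.det := by
      rw [hC]; simp only [det_mul]; ring
    rw [this, det_nonsing_inv, Ring.inverse_eq_inv', hB.det_eq_ofReal, hA.det_eq_ofReal]
    push_cast
    simp
    ring
  have hM : (C * B * Cᴴ).PosDef := by
    rw [(hB.posSemidef.mul_mul_conjTranspose_same C).posDef_iff_det_ne_zero, hdet]
    exact_mod_cast (div_pos hB.re_det_pos hA.re_det_pos).ne'
  have htr : (C * B * Cᴴ).trace = (A⁻¹ * B).trace := by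
    rw [Matrix.trace_mul_comm, hC, Matrix.mul_assoc]
  have := hM.log_re_det_le_s6
  rw [hdet, htr, Complex.ofReal_re, Real.log_div hB.re_det_pos.ne' hA.re_det_pos.ne'] at this
  rw [Matrix.mul_sub, nonsing_inv_mul _ hAu, trace_sub, trace_one]
  simpa using this

end Matrix

section Rate

variable {nT nR : ℕ} {H : Matrix (Fin nR) (Fin nT) ℂ} {Rw : Matrix (Fin nR) (Fin nR) ℂ}

/-- The covariance of the received signal is positive definite. -/
lemma posDef_add_mul_mul_conjTranspose (hRw : Rw.PosDef)
    {Q : Matrix (Fin nT) (Fin nT) ℂ} (hQ : Q.PosSemidef) : (Rw + H * Q * Hᴴ).PosDef :=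
  hRw.add_posSemidef (hQ.mul_mul_conjTranspose_same H)

lemma rate_eq_log_sub_log (hRw : Rw.PosDef) {Q : Matrix (Fin nT) (Fin nT) ℂ}
    (hQ : Q.PosSemidef) :
    rate H Rw Q =
      (Real.log (Rw + H * Q * Hᴴ).det.re - Real.log Rw.det.re) / Real.log 2 := by
  have hB := posDef_add_mul_mul_conjTranspose (H := H) hRw hQ
  have hu : IsUnit Rw.det := hRw.det_pos.ne'.isUnit
  have hdet : (1 + Hᴴ * Rw⁻¹ * H * Q).det
      = (((Rw + H * Q * Hᴴ).det.re / Rw.det.re : ℝ) : ℂ) := by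
    have h1 : (1 + Hᴴ * Rw⁻¹ * H * Q).det = (Rw⁻¹ * (Rw + H * Q * Hᴴ)).det := by
      rw [Matrix.mul_add, nonsing_inv_mul _ hu,
        show Hᴴ * Rw⁻¹ * H * Q = Hᴴ * (Rw⁻¹ * H * Q) by simp only [Matrix.mul_assoc],
        det_one_add_mul_comm]
      simp only [Matrix.mul_assoc]
    rw [h1, det_mul, det_nonsing_inv, Ring.inverse_eq_inv', hB.det_eq_ofReal,
      hRw.det_eq_ofReal]
    push_cast
    simp
    ring
  rw [rate, hdet, Complex.ofReal_re, Real.logb,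
    Real.log_div hB.re_det_pos.ne' hRw.re_det_pos.ne']

/-- Gradient inequality for the concave function `rate`. -/
lemma rate_sub_rate_le (hRw : Rw.PosDef) {Q Y : Matrix (Fin nT) (Fin nT) ℂ}
    (hQ : Q.PosSemidef) (hY : Y.PosSemidef) :
    rate H Rw Q - rate H Rw Y ≤
      (Hᴴ * (Rw + H * Y * Hᴴ)⁻¹ * H * (Q - Y)).trace.re / Real.log 2 := by
  have key := (posDef_add_mul_mul_conjTranspose (H := H) hRw hY).log_re_det_sub_le
    (posDef_add_mul_mul_conjTranspose (H := H) hRw hQ)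
  have htr : (Hᴴ * (Rw + H * Y * Hᴴ)⁻¹ * H * (Q - Y)).trace
      = ((Rw + H * Y * Hᴴ)⁻¹ * (Rw + H * Q * Hᴴ - (Rw + H * Y * Hᴴ))).trace := by
    rw [add_sub_add_left_eq_sub, ← Matrix.sub_mul, ← Matrix.mul_sub, Matrix.mul_assoc Hᴴ,
      Matrix.mul_assoc Hᴴ, Matrix.trace_mul_comm]
    simp only [Matrix.mul_assoc]
  rw [htr, rate_eq_log_sub_log hRw hQ, rate_eq_log_sub_log hRw hY, ← sub_div]
  have : 0 < Real.log 2 := Real.log_pos one_lt_two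
  gcongr
  linarith

end Rate

/-- Pseudo-convexity of the energy on the PSD cone where the rate is positive:
`E(Q) < E(Y)` implies `Re tr(G(Y)(Q − Y)) < 0`. -/
theorem energy_pseudoconvex {nT nR : ℕ}
    (H : Matrix (Fin nR) (Fin nT) ℂ) (Rw : Matrix (Fin nR) (Fin nR) ℂ) (hRw : Rw.PosDef)
    (c : ℝ) (hc : 0 < c)
    (Q Y : Matrix (Fin nT) (Fin nT) ℂ) (hQ : Q.PosSemidef) (hY : Y.PosSemidef)
    (hrQ : 0 < rate H Rw Q) (hrY : 0 < rate H Rw Y)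
    (hE : energy H Rw c Q < energy H Rw c Y) :
    (((gradE H Rw c Y) * (Q - Y)).trace).re < 0 := by
  have hlin : ((gradE H Rw c Y) * (Q - Y)).trace.re
      = c / rate H Rw Y ^ 2 * (rate H Rw Y * (Q.trace.re - Y.trace.re)
        - Y.trace.re * ((Hᴴ * (Rw + H * Y * Hᴴ)⁻¹ * H * (Q - Y)).trace.re / Real.log 2)) := by
    rw [gradE, Matrix.smul_mul, Matrix.sub_mul, Matrix.smul_mul, Matrix.smul_mul, Matrix.one_mul,
      trace_smul, trace_sub, trace_smul, trace_smul, trace_sub Q Y]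
    simp only [Complex.smul_re, Complex.sub_re, smul_eq_mul]
    ring
  have hconc := mul_le_mul_of_nonneg_left (rate_sub_rate_le (H := H) hRw hQ hY)
    (Complex.nonneg_iff.1 hY.trace_nonneg).1
  have hcross : Q.trace.re * rate H Rw Y < Y.trace.re * rate H Rw Q := by
    rw [energy, energy, div_lt_div_iff₀ hrQ hrY, mul_assoc, mul_assoc] at hE
    exact lt_of_mul_lt_mul_left hE hc.le
  rw [hlin]
  exact mul_neg_of_pos_of_neg (by positivity) (by linarith)
end

section
/- For every Hermitian positive semidefinite matrix A ∈ ℂ^{n×n}, one has Re tr( A·(I + A)⁻¹ ) ≤ ln det(I + A) (the determinant is real and ≥ 1, so the right-hand side is a nonnegative real). -/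
open Matrix ComplexOrder

theorem Matrix.PosDef.log_det_re_le_trace_re_sub_card {ι : Type*} [Fintype ι] [DecidableEq ι]
    {C : Matrix ι ι ℂ} (hC : C.PosDef) :
    Real.log C.det.re ≤ C.trace.re - Fintype.card ι := by
  have hdet : C.det.re = ∏ i, hC.isHermitian.eigenvalues i := by
    rw [hC.isHermitian.det_eq_prod_eigenvalues, ← RCLike.ofReal_prod]
    exact Complex.ofReal_re _
  have htr : C.trace.re = ∑ i, hC.isHermitian.eigenvalues i := by
    rw [hC.isHermitian.trace_eq_sum_eigenvalues, ← RCLike.ofReal_sum]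
    exact Complex.ofReal_re _
  rw [hdet, htr, Real.log_prod fun i _ => (hC.eigenvalues_pos i).ne']
  calc ∑ i, Real.log (hC.isHermitian.eigenvalues i)
      ≤ ∑ i, (hC.isHermitian.eigenvalues i - 1) :=
        Finset.sum_le_sum fun i _ => Real.log_le_sub_one_of_pos (hC.eigenvalues_pos i)
    _ = ∑ i, hC.isHermitian.eigenvalues i - Fintype.card ι := by simp

/-- For Hermitian PSD `A`, `Re tr(A (I + A)⁻¹) ≤ ln det(I + A)`:
the inequality `⟨∇r(Q), Q⟩ ≤ r(Q)` from concavity of the log-det rate function. -/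
theorem trace_inv_le_logdet {n : ℕ} (A : Matrix (Fin n) (Fin n) ℂ) (hA : A.PosSemidef) :
    ((A * (1 + A)⁻¹).trace).re ≤ Real.log ((1 + A).det).re := by
  have hB : (1 + A).PosDef := PosDef.one.add_posSemidef hA
  have hmul : A * (1 + A)⁻¹ = 1 - (1 + A)⁻¹ := by
    rw [eq_sub_iff_add_eq', ← one_add_mul A, mul_nonsing_inv _ hB.det_pos.ne'.isUnit]
  have hdet : (1 + A)⁻¹.det.re = ((1 + A).det.re)⁻¹ := by
    obtain ⟨r, hr⟩ : ∃ r : ℝ, (1 + A).det = r :=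
      ⟨_, (Complex.eq_re_of_ofReal_le hB.det_pos.le)⟩
    rw [det_nonsing_inv, Ring.inverse_eq_inv', hr, ← Complex.ofReal_inv, Complex.ofReal_re,
      Complex.ofReal_re]
  have h := hB.inv.log_det_re_le_trace_re_sub_card
  rw [hdet, Real.log_inv, Fintype.card_fin] at h
  rw [hmul, trace_sub, trace_one, Fintype.card_fin, Complex.sub_re, Complex.natCast_re]
  linarith
end

section
/- Let R ∈ ℂ^{m×m} be Hermitian positive definite, k a positive integer, H_j ∈ ℂ^{m×n_j}, and Q_j, Q'_j ∈ ℂ^{n_j×n_j} Hermitian positive semidefinite, for j = 1,…,k. Write A := R + Σ_j H_j Q_j H_jᴴ and B := R + Σ_j H_j Q'_j H_jᴴ (both Hermitian positive definite). Then ln det(A) ≤ ln det(B) + Σ_{j=1}^{k} Re tr( H_jᴴ B⁻¹ H_j · (Q_j − Q'_j) ). (First-order linearization of the concave log-det interference term overestimates it; this is the key inequality guaranteeing that the surrogate constraints g̃ are inner convex approximations of the latency constraints g, property C4.) -/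
open Matrix ComplexOrder

namespace Matrix.PosDef

variable {ι : Type*} [Fintype ι]

/-- The log-determinant of a positive definite matrix is at most its trace minus its size. -/
theorem log_det_le_trace_sub_card [DecidableEq ι] {M : Matrix ι ι ℂ} (hM : M.PosDef) :
    Real.log M.det.re ≤ M.trace.re - Fintype.card ι := by
  have hdet : M.det.re = ∏ i, hM.isHermitian.eigenvalues i := by
    conv_lhs => rw [hM.isHermitian.det_eq_prod_eigenvalues]
    simp [← Complex.ofReal_prod]
  have htr : M.trace.re = ∑ i, hM.isHermitian.eigenvalues i := by
    conv_lhs => rw [hM.isHermitian.trace_eq_sum_eigenvalues]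
    simp
  rw [hdet, htr, Real.log_prod fun i _ => (hM.eigenvalues_pos i).ne']
  calc ∑ i, Real.log (hM.isHermitian.eigenvalues i)
      ≤ ∑ i, (hM.isHermitian.eigenvalues i - 1) :=
        Finset.sum_le_sum fun i _ => Real.log_le_sub_one_of_pos (hM.eigenvalues_pos i)
    _ = _ := by simp

open scoped MatrixOrder in
/-- The log-determinant lies below its first-order expansion at any positive definite matrix. -/
theorem log_det_le_log_det_add_trace [DecidableEq ι] {A B : Matrix ι ι ℂ}
    (hA : A.PosDef) (hB : B.PosDef) :
    Real.log A.det.re ≤ Real.log B.det.re + (B⁻¹ * (A - B)).trace.re := by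
  have hdet : IsUnit B.det := (isUnit_iff_isUnit_det B).mp hB.isUnit
  obtain ⟨S, hS⟩ := CStarAlgebra.nonneg_iff_eq_star_mul_self.mp hB.inv.posSemidef.nonneg
  have hSunit : IsUnit S := by
    have h : IsUnit (star S * S).det := by
      rw [← hS]
      exact (isUnit_iff_isUnit_det _).mp hB.inv.isUnit
    rw [det_mul] at h
    exact (isUnit_iff_isUnit_det S).mpr (isUnit_of_mul_isUnit_right h)
  have hM : (S * A * star S).PosDef := hSunit.posDef_star_right_conjugate_iff.mpr hA
  have hM_trace : (S * A * star S).trace = (B⁻¹ * A).trace := by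
    rw [trace_mul_comm, ← Matrix.mul_assoc, ← hS]
  have hM_det : (S * A * star S).det * B.det = A.det := by
    have h : (star S).det * S.det * B.det = 1 := by
      rw [← det_mul, ← hS, ← det_mul, nonsing_inv_mul _ hdet, det_one]
    rw [det_mul, det_mul]
    linear_combination A.det * h
  obtain ⟨hMpos, hMim⟩ := Complex.pos_iff.mp hM.det_pos
  obtain ⟨hBpos, -⟩ := Complex.pos_iff.mp hB.det_pos
  have hre : A.det.re = (S * A * star S).det.re * B.det.re := by
    rw [← hM_det, Complex.mul_re, ← hMim]
    ring
  have key := hM.log_det_le_trace_sub_card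
  rw [hM_trace] at key
  rw [hre, Real.log_mul hMpos.ne' hBpos.ne', Matrix.mul_sub, nonsing_inv_mul _ hdet, trace_sub,
    trace_one, Complex.sub_re, Complex.natCast_re]
  linarith

/-- Adding congruence transforms of positive semidefinite matrices preserves definiteness. -/
theorem add_sum_mul_mul_conjTranspose {κ : Type*} [Fintype κ] {n : κ → Type*}
    [∀ j, Fintype (n j)] {R : Matrix ι ι ℂ} (hR : R.PosDef) (H : ∀ j, Matrix ι (n j) ℂ)
    {Q : ∀ j, Matrix (n j) (n j) ℂ} (hQ : ∀ j, (Q j).PosSemidef) :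
    (R + ∑ j, H j * Q j * (H j)ᴴ).PosDef :=
  hR.add_posSemidef <| posSemidef_sum _ fun j _ => (hQ j).mul_mul_conjTranspose_same (H j)

end Matrix.PosDef

/-- First-order upper bound of the concave log-det term (property C4 of the inner
convex approximation): with `A = R + Σ_j H_j Q_j H_jᴴ` and `B = R + Σ_j H_j Q'_j H_jᴴ`,
`ln det(A) ≤ ln det(B) + Σ_j Re tr(H_jᴴ B⁻¹ H_j (Q_j − Q'_j))`. -/
theorem logdet_le_linearization {m k : ℕ} (hk : 0 < k) (n : Fin k → ℕ)
    (R : Matrix (Fin m) (Fin m) ℂ) (hR : R.PosDef)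
    (H : ∀ j : Fin k, Matrix (Fin m) (Fin (n j)) ℂ)
    (Q Q' : ∀ j : Fin k, Matrix (Fin (n j)) (Fin (n j)) ℂ)
    (hQ : ∀ j, (Q j).PosSemidef) (hQ' : ∀ j, (Q' j).PosSemidef) :
    Real.log ((R + ∑ j, H j * Q j * (H j)ᴴ).det).re ≤
      Real.log ((R + ∑ j, H j * Q' j * (H j)ᴴ).det).re
        + ∑ j, (((H j)ᴴ * (R + ∑ l, H l * Q' l * (H l)ᴴ)⁻¹ * H j
            * (Q j - Q' j)).trace).re := by
  refine ((hR.add_sum_mul_mul_conjTranspose H hQ).log_det_le_log_det_add_trace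
    (hR.add_sum_mul_mul_conjTranspose H hQ')).trans_eq ?_
  congr 1
  rw [add_sub_add_left_eq_sub, ← Finset.sum_sub_distrib, Matrix.mul_sum, trace_sum, Complex.re_sum]
  refine Finset.sum_congr rfl fun j _ => ?_
  rw [← Matrix.sub_mul, ← Matrix.mul_sub, ← Matrix.mul_assoc, trace_mul_comm]
  simp only [Matrix.mul_assoc]
end

section
/- The function ψ has a unique minimizer Y★ over the cone of Hermitian positive semidefinite n×n matrices, and for any spectral decomposition c·Yν − Ω = U·diag(d_1,…,d_n)·Uᴴ with U unitary, the minimizer is Y★ = U·diag(y_1,…,y_n)·Uᴴ, where y_j = max{ 0, −(σ²/2 − d_j/(2c)) + √( (σ²/2 + d_j/(2c))² + λ/c ) } for j = 1,…,n. -/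
open Matrix ComplexOrder

/-- Objective of the `Y`-subproblem:
`ψ(Y) = −λ ln det(σ² I + Y) + Re tr(Ω Y) + (c/2)‖Y − Yν‖_F²`. -/
noncomputable def psiY {n : ℕ} (σ2 lam c : ℝ) (Ynu Ω : Matrix (Fin n) (Fin n) ℂ)
    (Y : Matrix (Fin n) (Fin n) ℂ) : ℝ :=
  -lam * Real.log ((σ2 • (1 : Matrix (Fin n) (Fin n) ℂ) + Y).det).re
    + ((Ω * Y).trace).re
    + (c / 2) * (((Y - Ynu)ᴴ * (Y - Ynu)).trace).re

/-- The tangent-line bound `ln det M ≤ tr M − n` for positive definite `M`. -/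
theorem log_det_re_le_trace_re_sub_card {n : ℕ} {M : Matrix (Fin n) (Fin n) ℂ}
    (hM : M.PosDef) : Real.log M.det.re ≤ M.trace.re - n := by
  have hdet : M.det.re = ∏ i, hM.isHermitian.eigenvalues i := by
    have h := congrArg Complex.re hM.isHermitian.det_eq_prod_eigenvalues
    rw [h, ← Complex.ofReal_re (∏ i, hM.isHermitian.eigenvalues i)]
    push_cast
    rfl
  have htr : M.trace.re = ∑ i, hM.isHermitian.eigenvalues i := by
    have h := congrArg Complex.re hM.isHermitian.trace_eq_sum_eigenvalues
    rw [h, ← Complex.ofReal_re (∑ i, hM.isHermitian.eigenvalues i)]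
    push_cast
    rfl
  rw [hdet, htr, Real.log_prod (fun i _ => (hM.eigenvalues_pos i).ne')]
  calc ∑ i, Real.log (hM.isHermitian.eigenvalues i)
      ≤ ∑ i, (hM.isHermitian.eigenvalues i - 1) :=
        Finset.sum_le_sum fun i _ => Real.log_le_sub_one_of_pos (hM.eigenvalues_pos i)
    _ = _ := by simp

/-- The tangent-line bound for `ln det` at a positive diagonal matrix. -/
theorem log_det_re_le_sum_log_add {n : ℕ} {B : Matrix (Fin n) (Fin n) ℂ} (hB : B.PosDef)
    {a : Fin n → ℝ} (ha : ∀ j, 0 < a j) :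
    Real.log B.det.re ≤ ∑ j, (Real.log (a j) + ((B j j).re / a j - 1)) := by
  set s : Fin n → ℝ := fun j => (Real.sqrt (a j))⁻¹ with hs
  have hspos : ∀ j, 0 < s j := fun j => inv_pos.mpr (Real.sqrt_pos.mpr (ha j))
  have hss : ∀ j, s j * s j = (a j)⁻¹ := fun j => by
    rw [hs, ← mul_inv, Real.mul_self_sqrt (ha j).le]
  set S : Matrix (Fin n) (Fin n) ℂ := diagonal fun j => (s j : ℂ) with hS
  have hSH : Sᴴ = S := by
    rw [hS, diagonal_conjTranspose]
    congr 1
    ext j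
    simp
  have hSdet : S.det = ((∏ j, s j : ℝ) : ℂ) := by
    rw [hS, det_diagonal]
    push_cast
    rfl
  have hSunit : IsUnit S := by
    rw [isUnit_iff_isUnit_det, hSdet, isUnit_iff_ne_zero]
    exact_mod_cast (Finset.prod_pos fun j _ => hspos j).ne'
  have hM : (Sᴴ * B * S).PosDef :=
    hB.conjTranspose_mul_mul_same (mulVec_injective_of_isUnit hSunit)
  have hBdet : 0 < B.det.re := (Complex.lt_def.mp hB.det_pos).1
  have hdet : (Sᴴ * B * S).det.re = (∏ j, (a j)⁻¹) * B.det.re := by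
    have : (Sᴴ * B * S).det = ((∏ j, (a j)⁻¹ : ℝ) : ℂ) * B.det := by
      rw [hSH, det_mul, det_mul, hSdet]
      simp_rw [← hss, Finset.prod_mul_distrib]
      push_cast
      ring
    rw [this, Complex.re_ofReal_mul]
  have htr : (Sᴴ * B * S).trace.re = ∑ j, (B j j).re / a j := by
    rw [hSH, trace, Complex.re_sum]
    refine Finset.sum_congr rfl fun j _ => ?_
    rw [hS, diag_apply, mul_diagonal, diagonal_mul, mul_right_comm, ← Complex.ofReal_mul, hss,
      Complex.re_ofReal_mul]
    ring
  have h := log_det_re_le_trace_re_sub_card hM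
  rw [hdet, htr, Real.log_mul (Finset.prod_pos fun j _ => inv_pos.mpr (ha j)).ne' hBdet.ne',
    Real.log_prod fun j _ => (inv_pos.mpr (ha j)).ne'] at h
  simp only [Real.log_inv, Finset.sum_neg_distrib] at h
  simp only [Finset.sum_add_distrib, Finset.sum_sub_distrib, Finset.sum_const, Finset.card_univ,
    Fintype.card_fin, nsmul_eq_mul, mul_one]
  linarith

/-- The closed-form eigenvalue of the minimizer satisfies the scalar optimality conditions. -/
theorem psiY_scalar_optimality {σ2 lam c : ℝ} (hσ2 : 0 < σ2) (hlam : 0 ≤ lam) (hc : 0 < c)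
    (d : ℝ) {y : ℝ}
    (hy : y = max 0 (-(σ2 / 2 - d / (2 * c)) + Real.sqrt ((σ2 / 2 + d / (2 * c)) ^ 2 + lam / c)))
    {z : ℝ} (hz : 0 ≤ z) :
    0 ≤ (-(lam / (σ2 + y)) + c * y - d) * (z - y) := by
  set s := Real.sqrt ((σ2 / 2 + d / (2 * c)) ^ 2 + lam / c) with hs
  have hs0 : 0 ≤ s := Real.sqrt_nonneg _
  have hs2 : s ^ 2 = (σ2 / 2 + d / (2 * c)) ^ 2 + lam / c := Real.sq_sqrt (by positivity)
  obtain ⟨e, rfl⟩ : ∃ e, d = 2 * c * e := ⟨d / (2 * c), by field_simp⟩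
  obtain ⟨l, rfl⟩ : ∃ l, lam = c * l := ⟨lam / c, by field_simp⟩
  have he : 2 * c * e / (2 * c) = e := by field_simp
  have hl : c * l / c = l := by field_simp
  rw [he, hl] at hs2
  rw [he] at hy
  rcases le_total 0 (-(σ2 / 2 - e) + s) with h | h
  · rw [max_eq_right h] at hy
    have hp : 0 < σ2 + y := by linarith
    have : -(c * l / (σ2 + y)) + c * y - 2 * c * e = 0 := by
      have hl' : l = s ^ 2 - (σ2 / 2 + e) ^ 2 := by linarith
      field_simp
      rw [hl', hy]
      ring
    rw [this, zero_mul]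
  · rw [max_eq_left h] at hy
    subst hy
    have hk : 0 ≤ -(l / σ2) - 2 * e := by
      have h1 : s ^ 2 ≤ (σ2 / 2 - e) ^ 2 := by gcongr; linarith
      have h2 : l / σ2 ≤ -(2 * e) := by
        rw [div_le_iff₀ hσ2]
        nlinarith
      linarith
    have : (-(c * l / (σ2 + 0)) + c * 0 - 2 * c * e) * (z - 0) = c * (-(l / σ2) - 2 * e) * z := by
      rw [add_zero]
      ring
    rw [this]
    positivity

/-- The objective in the eigenbasis of `c Yν − Ω`, up to a constant. -/
theorem psiY_unitary_conj {n : ℕ} {σ2 lam c : ℝ} {Ynu Ω U Z : Matrix (Fin n) (Fin n) ℂ}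
    {d : Fin n → ℝ} (hYnu : Ynu.IsHermitian) (hZ : Z.IsHermitian)
    (hU : U ∈ unitaryGroup (Fin n) ℂ)
    (hd : c • Ynu - Ω = U * diagonal (fun j => (d j : ℂ)) * Uᴴ) :
    psiY σ2 lam c Ynu Ω (U * Z * Uᴴ) =
      -lam * Real.log (σ2 • (1 : Matrix (Fin n) (Fin n) ℂ) + Z).det.re
        + c / 2 * (Z * Z).trace.re - ∑ j, d j * (Z j j).re + c / 2 * (Ynu * Ynu).trace.re := by
  have hUU : Uᴴ * U = 1 := mem_unitaryGroup_iff'.mp hU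
  have hUU' : U * Uᴴ = 1 := mem_unitaryGroup_iff.mp hU
  have hdet : (σ2 • (1 : Matrix (Fin n) (Fin n) ℂ) + U * Z * Uᴴ).det =
      (σ2 • (1 : Matrix (Fin n) (Fin n) ℂ) + Z).det := by
    have : σ2 • (1 : Matrix (Fin n) (Fin n) ℂ) + U * Z * Uᴴ =
        U * (σ2 • (1 : Matrix (Fin n) (Fin n) ℂ) + Z) * Uᴴ := by
      rw [mul_add, add_mul, mul_smul_comm, mul_one, smul_mul_assoc, hUU']
    rw [this, det_mul_right_comm, hUU', one_mul]
  set Y := U * Z * Uᴴ with hY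
  have hYH : Yᴴ = Y := by
    rw [hY, conjTranspose_mul, conjTranspose_mul, conjTranspose_conjTranspose, hZ.eq, mul_assoc]
  have hYY : (Y * Y).trace = (Z * Z).trace := by
    have : Y * Y = U * (Z * Z) * Uᴴ := by
      calc Y * Y = U * Z * (Uᴴ * U) * Z * Uᴴ := by simp only [hY, mul_assoc]
        _ = _ := by rw [hUU, mul_one]; simp only [mul_assoc]
    rw [this, trace_mul_comm, ← mul_assoc, hUU, one_mul]
  have hlin : ((c • Ynu - Ω) * Y).trace.re = ∑ j, d j * (Z j j).re := by
    have : (c • Ynu - Ω) * Y = U * (diagonal (fun j => (d j : ℂ)) * Z) * Uᴴ := by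
      rw [hd]
      calc _ = U * diagonal (fun j => (d j : ℂ)) * (Uᴴ * U) * Z * Uᴴ := by simp only [hY, mul_assoc]
        _ = _ := by rw [hUU, mul_one]; simp only [mul_assoc]
    rw [this, trace_mul_comm, ← mul_assoc, hUU, one_mul, trace, Complex.re_sum]
    simp [diagonal_mul]
  rw [sub_mul, trace_sub, smul_mul_assoc, trace_smul, Complex.sub_re, Complex.smul_re,
    smul_eq_mul] at hlin
  have hsq : ((Y - Ynu)ᴴ * (Y - Ynu)).trace =
      (Z * Z).trace - 2 * (Ynu * Y).trace + (Ynu * Ynu).trace := by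
    rw [conjTranspose_sub, hYH, hYnu.eq, sub_mul, mul_sub, mul_sub, trace_sub, trace_sub,
      trace_sub, hYY, trace_mul_comm Y Ynu]
    ring
  rw [psiY, hdet, hsq, ← hlin]
  simp only [Complex.add_re, Complex.sub_re, Complex.mul_re, Complex.re_ofNat, Complex.im_ofNat]
  ring

/-- Quadratic growth of the objective around the closed-form minimizer. -/
theorem psiY_quadratic_growth {n : ℕ} {σ2 lam c : ℝ} (hσ2 : 0 < σ2) (hlam : 0 ≤ lam) (hc : 0 < c)
    {Ynu Ω U Z : Matrix (Fin n) (Fin n) ℂ} {d y : Fin n → ℝ} (hYnu : Ynu.IsHermitian)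
    (hZ : Z.PosSemidef) (hU : U ∈ unitaryGroup (Fin n) ℂ)
    (hd : c • Ynu - Ω = U * diagonal (fun j => (d j : ℂ)) * Uᴴ)
    (hy : ∀ j, y j = max 0 (-(σ2 / 2 - d j / (2 * c))
      + Real.sqrt ((σ2 / 2 + d j / (2 * c)) ^ 2 + lam / c))) :
    psiY σ2 lam c Ynu Ω (U * diagonal (fun j => (y j : ℂ)) * Uᴴ)
        + c / 2 * ((Z - diagonal (fun j => (y j : ℂ)))ᴴ
          * (Z - diagonal (fun j => (y j : ℂ)))).trace.re
      ≤ psiY σ2 lam c Ynu Ω (U * Z * Uᴴ) := by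
  have hy0 : ∀ j, 0 ≤ y j := fun j => by rw [hy]; exact le_max_left _ _
  have ha : ∀ j, 0 < σ2 + y j := fun j => by linarith [hy0 j]
  set D : Matrix (Fin n) (Fin n) ℂ := diagonal fun j => (y j : ℂ) with hD
  have hDH : D.IsHermitian := by
    rw [hD, IsHermitian, diagonal_conjTranspose]
    congr 1
    ext j
    simp
  have hsmul : σ2 • (1 : Matrix (Fin n) (Fin n) ℂ) = diagonal fun _ => (σ2 : ℂ) := by
    ext i j
    by_cases h : i = j <;> simp [h]
  have hone : (σ2 • (1 : Matrix (Fin n) (Fin n) ℂ)).PosDef := by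
    rw [hsmul, posDef_diagonal_iff]
    intro _
    exact_mod_cast hσ2
  have hlogD : Real.log (σ2 • (1 : Matrix (Fin n) (Fin n) ℂ) + D).det.re
      = ∑ j, Real.log (σ2 + y j) := by
    have : (σ2 • (1 : Matrix (Fin n) (Fin n) ℂ) + D).det = ((∏ j, (σ2 + y j) : ℝ) : ℂ) := by
      rw [hsmul, hD, diagonal_add, det_diagonal]
      push_cast
      rfl
    rw [this, Complex.ofReal_re, Real.log_prod fun j _ => (ha j).ne']
  have hlogZ := log_det_re_le_sum_log_add (hone.add_posSemidef hZ) ha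
  have hdiag : ∀ j, ((σ2 • (1 : Matrix (Fin n) (Fin n) ℂ) + Z) j j).re = σ2 + (Z j j).re := by
    intro j
    simp
  simp only [hdiag, Finset.sum_add_distrib] at hlogZ
  have hDZ : (D * Z).trace.re = ∑ j, y j * (Z j j).re := by
    rw [trace, Complex.re_sum]
    simp [hD, diagonal_mul]
  have hDD : (D * D).trace.re = ∑ j, y j * y j := by
    rw [trace, Complex.re_sum]
    simp [hD]
  have hsq : ((Z - D)ᴴ * (Z - D)).trace = (Z * Z).trace - 2 * (D * Z).trace + (D * D).trace := by
    rw [conjTranspose_sub, hDH.eq, hZ.isHermitian.eq, sub_mul, mul_sub, mul_sub, trace_sub,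
      trace_sub, trace_sub, trace_mul_comm Z D]
    ring
  have hDre : ∀ j, (D j j).re = y j := fun j => by simp [hD]
  have hsum : 0 ≤ ∑ j, (-(lam / (σ2 + y j)) + c * y j - d j) * ((Z j j).re - y j) :=
    Finset.sum_nonneg fun j _ => psiY_scalar_optimality hσ2 hlam hc (d j) (hy j)
      (Complex.le_def.mp (hZ.diag_nonneg (i := j))).1
  have hexp : ∑ j, (-(lam / (σ2 + y j)) + c * y j - d j) * ((Z j j).re - y j) =
      -lam * ∑ j, ((σ2 + (Z j j).re) / (σ2 + y j) - 1) + c * ∑ j, y j * (Z j j).re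
        - c * ∑ j, y j * y j - ∑ j, d j * (Z j j).re + ∑ j, d j * y j := by
    simp only [Finset.mul_sum, ← Finset.sum_add_distrib, ← Finset.sum_sub_distrib]
    refine Finset.sum_congr rfl fun j _ => ?_
    have := (ha j).ne'
    field_simp
    ring
  have hmul := mul_le_mul_of_nonneg_left hlogZ hlam
  rw [psiY_unitary_conj hYnu hDH hU hd, psiY_unitary_conj hYnu hZ.isHermitian hU hd, hlogD, hsq]
  simp only [Complex.add_re, Complex.sub_re, Complex.mul_re, Complex.re_ofNat, Complex.im_ofNat,
    hDZ, hDD, hDre]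
  linarith

/-- The `Y`-subproblem has a unique minimizer over the PSD cone, and for any unitary
spectral decomposition `c Yν − Ω = U diag(d) Uᴴ`, the minimizer is
`Y⋆ = U diag(y) Uᴴ` with
`y_j = max{0, −(σ²/2 − d_j/(2c)) + √((σ²/2 + d_j/(2c))² + λ/c)}`. -/
theorem psiY_unique_minimizer {n : ℕ}
    (σ2 lam c : ℝ) (hσ2 : 0 < σ2) (hlam : 0 ≤ lam) (hc : 0 < c)
    (Ynu Ω : Matrix (Fin n) (Fin n) ℂ) (hYnu : Ynu.PosSemidef) (hΩ : Ω.PosSemidef) :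
    (∃! Y : Matrix (Fin n) (Fin n) ℂ, Y.PosSemidef ∧
      ∀ Y' : Matrix (Fin n) (Fin n) ℂ, Y'.PosSemidef →
        psiY σ2 lam c Ynu Ω Y ≤ psiY σ2 lam c Ynu Ω Y') ∧
    (∀ (U : Matrix (Fin n) (Fin n) ℂ) (d : Fin n → ℝ),
      U ∈ Matrix.unitaryGroup (Fin n) ℂ →
      c • Ynu - Ω = U * Matrix.diagonal (fun j => (d j : ℂ)) * Uᴴ →
      ∀ Ystar : Matrix (Fin n) (Fin n) ℂ,
        Ystar = U * Matrix.diagonal (fun j =>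
          ((max 0 (-(σ2 / 2 - d j / (2 * c))
              + Real.sqrt ((σ2 / 2 + d j / (2 * c)) ^ 2 + lam / c)) : ℝ) : ℂ)) * Uᴴ →
        Ystar.PosSemidef ∧
        (∀ Y' : Matrix (Fin n) (Fin n) ℂ, Y'.PosSemidef →
          psiY σ2 lam c Ynu Ω Ystar ≤ psiY σ2 lam c Ynu Ω Y') ∧
        (∀ Y : Matrix (Fin n) (Fin n) ℂ, Y.PosSemidef →
          (∀ Y' : Matrix (Fin n) (Fin n) ℂ, Y'.PosSemidef →
            psiY σ2 lam c Ynu Ω Y ≤ psiY σ2 lam c Ynu Ω Y') →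
          Y = Ystar)) := by
  have main : ∀ (U : Matrix (Fin n) (Fin n) ℂ) (d : Fin n → ℝ),
      U ∈ Matrix.unitaryGroup (Fin n) ℂ →
      c • Ynu - Ω = U * Matrix.diagonal (fun j => (d j : ℂ)) * Uᴴ →
      ∀ Ystar : Matrix (Fin n) (Fin n) ℂ,
        Ystar = U * Matrix.diagonal (fun j =>
          ((max 0 (-(σ2 / 2 - d j / (2 * c))
              + Real.sqrt ((σ2 / 2 + d j / (2 * c)) ^ 2 + lam / c)) : ℝ) : ℂ)) * Uᴴ →
        Ystar.PosSemidef ∧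
        (∀ Y' : Matrix (Fin n) (Fin n) ℂ, Y'.PosSemidef →
          psiY σ2 lam c Ynu Ω Ystar ≤ psiY σ2 lam c Ynu Ω Y') ∧
        (∀ Y : Matrix (Fin n) (Fin n) ℂ, Y.PosSemidef →
          (∀ Y' : Matrix (Fin n) (Fin n) ℂ, Y'.PosSemidef →
            psiY σ2 lam c Ynu Ω Y ≤ psiY σ2 lam c Ynu Ω Y') →
          Y = Ystar) := by
    intro U d hU hd Ystar hYstar
    set y : Fin n → ℝ := fun j => max 0 (-(σ2 / 2 - d j / (2 * c))
      + Real.sqrt ((σ2 / 2 + d j / (2 * c)) ^ 2 + lam / c)) with hy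
    set D : Matrix (Fin n) (Fin n) ℂ := diagonal fun j => (y j : ℂ) with hD
    have hUU' : U * Uᴴ = 1 := mem_unitaryGroup_iff.mp hU
    have hstar : Ystar.PosSemidef := by
      rw [hYstar]
      refine PosSemidef.mul_mul_conjTranspose_same (PosSemidef.diagonal fun j => ?_) U
      exact Complex.zero_le_real.mpr (le_max_left _ _)
    have hconj : ∀ Y : Matrix (Fin n) (Fin n) ℂ, U * (Uᴴ * Y * U) * Uᴴ = Y := fun Y => by
      calc U * (Uᴴ * Y * U) * Uᴴ = (U * Uᴴ) * Y * (U * Uᴴ) := by simp only [mul_assoc]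
        _ = Y := by rw [hUU', one_mul, mul_one]
    have hgrowth : ∀ Y : Matrix (Fin n) (Fin n) ℂ, Y.PosSemidef →
        psiY σ2 lam c Ynu Ω Ystar
          + c / 2 * ((Uᴴ * Y * U - D)ᴴ * (Uᴴ * Y * U - D)).trace.re ≤ psiY σ2 lam c Ynu Ω Y := by
      intro Y hY
      have h := psiY_quadratic_growth hσ2 hlam hc hYnu.isHermitian
        (hY.conjTranspose_mul_mul_same U) hU hd (y := y) (fun _ => rfl)
      rwa [hconj, ← hYstar] at h
    have hnonneg : ∀ W : Matrix (Fin n) (Fin n) ℂ, 0 ≤ (Wᴴ * W).trace := fun W =>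
      (posSemidef_conjTranspose_mul_self W).trace_nonneg
    refine ⟨hstar, fun Y' hY' => ?_, fun Y hY hmin => ?_⟩
    · have h0 := (Complex.le_def.mp (hnonneg (Uᴴ * Y' * U - D))).1
      rw [Complex.zero_re] at h0
      have := mul_nonneg (half_pos hc).le h0
      linarith [hgrowth Y' hY']
    · have h0 := Complex.le_def.mp (hnonneg (Uᴴ * Y * U - D))
      rw [Complex.zero_re, Complex.zero_im] at h0
      have hle : c / 2 * ((Uᴴ * Y * U - D)ᴴ * (Uᴴ * Y * U - D)).trace.re ≤ 0 := by
        linarith [hgrowth Y hY, hmin Ystar hstar]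
      have hre := le_antisymm (nonpos_of_mul_nonpos_right hle (half_pos hc)) h0.1
      have hzero : ((Uᴴ * Y * U - D)ᴴ * (Uᴴ * Y * U - D)).trace = 0 :=
        Complex.ext hre h0.2.symm
      rw [trace_conjTranspose_mul_self_eq_zero_iff, sub_eq_zero] at hzero
      rw [hYstar, ← hzero, hconj]
  refine ⟨?_, main⟩
  have hH : (c • Ynu - Ω).IsHermitian := by
    rw [IsHermitian, conjTranspose_sub, conjTranspose_smul, hYnu.isHermitian.eq,
      hΩ.isHermitian.eq, star_trivial]
  obtain ⟨h1, h2, h3⟩ := main hH.eigenvectorUnitary hH.eigenvalues hH.eigenvectorUnitary.2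
    (by simpa [Unitary.conjStarAlgAut_apply, star_eq_conjTranspose, Function.comp_def]
      using hH.spectral_theorem) _ rfl
  exact ⟨_, ⟨h1, h2⟩, fun Y hY => h3 Y hY.1 hY.2⟩
end

section
/- Assume T̃ > 0 and c, w, f_T, P_T > 0. Then the feasible set X_s is a convex and compact subset of (Hermitian n_T×n_T complex matrices) × ℝ. -/
open Matrix ComplexOrder

namespace Matrix

open scoped MatrixOrder

variable {n : Type*} [Fintype n]

/-- A shifted and scaled Hermitian matrix has the shifted and scaled eigenvalues. -/
theorem IsHermitian.det_smul_one_add_smul [DecidableEq n] {M : Matrix n n ℂ} (hM : M.IsHermitian)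
    (a b : ℝ) :
    (a • (1 : Matrix n n ℂ) + b • M).det = ((∏ i, (a + b * hM.eigenvalues i) : ℝ) : ℂ) := by
  have hU : (hM.eigenvectorUnitary : Matrix n n ℂ) * star (hM.eigenvectorUnitary : Matrix n n ℂ)
      = 1 := Unitary.coe_mul_star_self _
  have hdiag : a • (1 : Matrix n n ℂ) + b • M = (hM.eigenvectorUnitary : Matrix n n ℂ) *
      diagonal (fun i => ((a + b * hM.eigenvalues i : ℝ) : ℂ)) *
        star (hM.eigenvectorUnitary : Matrix n n ℂ) := by
    have hD : diagonal (fun i => ((a + b * hM.eigenvalues i : ℝ) : ℂ)) =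
        a • (1 : Matrix n n ℂ) + b • diagonal (RCLike.ofReal ∘ hM.eigenvalues) := by
      ext i j
      by_cases h : i = j
      · subst h; simp
      · simp [h]
    conv_lhs => rw [hM.spectral_theorem, Unitary.conjStarAlgAut_apply]
    rw [hD, Matrix.mul_add, Matrix.add_mul]
    simp only [Matrix.mul_smul, Matrix.smul_mul, Matrix.mul_one, hU]
  rw [hdiag, det_mul_right_comm, hU, Matrix.one_mul, det_diagonal, Complex.ofReal_prod]

theorem PosDef.det_re_pos [DecidableEq n] {A : Matrix n n ℂ} (hA : A.PosDef) : 0 < A.det.re :=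
  (Complex.pos_iff.mp hA.det_pos).1

/-- The determinant of a congruence transform, in terms of real parts. -/
theorem re_det_conjTranspose_mul_mul [DecidableEq n] (S M : Matrix n n ℂ) :
    (Sᴴ * M * S).det.re = ‖S.det‖ ^ 2 * M.det.re := by
  have h : (Sᴴ * M * S).det = ((‖S.det‖ ^ 2 : ℝ) : ℂ) * M.det := by
    rw [det_mul, det_mul, det_conjTranspose, Complex.ofReal_pow, ← Complex.conj_mul']
    simp only [starRingEnd_apply]
    ring
  rw [h, Complex.re_ofReal_mul]

/-- Every positive definite matrix is `Sᴴ * S` for an invertible matrix `S`. -/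
theorem PosDef.exists_conjTranspose_mul_self [DecidableEq n] {A : Matrix n n ℂ} (hA : A.PosDef) :
    ∃ S : Matrix n n ℂ, IsUnit S.det ∧ A = Sᴴ * S := by
  obtain ⟨S, rfl⟩ := CStarAlgebra.nonneg_iff_eq_star_mul_self.mp hA.posSemidef.nonneg
  refine ⟨S, ?_, rfl⟩
  have h := hA.det_pos.ne'
  rw [det_mul] at h
  exact isUnit_iff_ne_zero.mpr (right_ne_zero_of_mul h)

/-- The logarithm of the determinant is concave on positive definite matrices. -/
theorem PosDef.log_det_concave [DecidableEq n] {A C : Matrix n n ℂ} (hA : A.PosDef)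
    (hC : C.PosDef) {a b : ℝ} (ha : 0 ≤ a) (hb : 0 ≤ b) (hab : a + b = 1) :
    a * Real.log A.det.re + b * Real.log C.det.re ≤ Real.log (a • A + b • C).det.re := by
  obtain ⟨S, hS, rfl⟩ := hA.exists_conjTranspose_mul_self
  have hSS : S⁻¹ * S = 1 := nonsing_inv_mul S hS
  have hSSH : Sᴴ * (S⁻¹)ᴴ = 1 := by rw [← conjTranspose_mul, hSS, conjTranspose_one]
  set M := (S⁻¹)ᴴ * C * S⁻¹ with hMdef
  have hCM : C = Sᴴ * M * S := by
    calc C = (Sᴴ * (S⁻¹)ᴴ) * C * (S⁻¹ * S) := by rw [hSS, hSSH, Matrix.one_mul, Matrix.mul_one]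
      _ = Sᴴ * M * S := by simp only [hMdef, Matrix.mul_assoc]
  have hM : M.PosDef := by
    have hunit : IsUnit S⁻¹ := isUnit_nonsing_inv_iff.mpr ((isUnit_iff_isUnit_det S).mpr hS)
    exact hC.conjTranspose_mul_mul_same (mulVec_injective_iff_isUnit.mpr hunit)
  have hl : ∀ i, 0 < hM.isHermitian.eigenvalues i := hM.eigenvalues_pos
  have hdet : ∀ x y : ℝ, (x • (Sᴴ * S) + y • C).det.re =
      ‖S.det‖ ^ 2 * ∏ i, (x + y * hM.isHermitian.eigenvalues i) := by
    intro x y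
    have : x • (Sᴴ * S) + y • C = Sᴴ * (x • (1 : Matrix n n ℂ) + y • M) * S := by
      rw [hCM]
      simp only [Matrix.mul_add, Matrix.add_mul, Matrix.mul_smul, Matrix.smul_mul, Matrix.mul_one]
    rw [this, re_det_conjTranspose_mul_mul, hM.isHermitian.det_smul_one_add_smul,
      Complex.ofReal_re]
  have hd : 0 < ‖S.det‖ ^ 2 := by
    have := norm_pos_iff.mpr hS.ne_zero
    positivity
  have hpos : ∀ i, 0 < a + b * hM.isHermitian.eigenvalues i := by
    intro i
    rcases hb.eq_or_lt with rfl | hb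
    · linarith
    · have := mul_pos hb (hl i)
      linarith
  have hA' : (Sᴴ * S).det.re = ‖S.det‖ ^ 2 := by simpa using hdet 1 0
  have hC' : C.det.re = ‖S.det‖ ^ 2 * ∏ i, hM.isHermitian.eigenvalues i := by
    simpa using hdet 0 1
  rw [hA', hC', hdet, Real.log_mul hd.ne' (Finset.prod_pos fun i _ => hl i).ne',
    Real.log_mul hd.ne' (Finset.prod_pos fun i _ => hpos i).ne',
    Real.log_prod fun i _ => (hl i).ne', Real.log_prod fun i _ => (hpos i).ne']
  have hsum : b * ∑ i, Real.log (hM.isHermitian.eigenvalues i) ≤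
      ∑ i, Real.log (a + b * hM.isHermitian.eigenvalues i) := by
    rw [Finset.mul_sum]
    refine Finset.sum_le_sum fun i _ => ?_
    simpa using strictConcaveOn_log_Ioi.concaveOn.2 (Set.mem_Ioi.mpr one_pos)
      (Set.mem_Ioi.mpr (hl i)) ha hb hab
  have : a * Real.log (‖S.det‖ ^ 2) + b * Real.log (‖S.det‖ ^ 2) = Real.log (‖S.det‖ ^ 2) := by
    rw [← add_mul, hab, one_mul]
  linarith

/-- The entries of a positive semidefinite matrix are bounded by its trace. -/
theorem PosSemidef.norm_apply_le_trace {Q : Matrix n n ℂ} (hQ : Q.PosSemidef) (i j : n) :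
    ‖Q i j‖ ≤ Q.trace.re := by
  classical
  obtain ⟨B, rfl⟩ := CStarAlgebra.nonneg_iff_eq_star_mul_self.mp hQ.nonneg
  have htr : (star B * B).trace.re = ∑ l, ∑ k, ‖B k l‖ ^ 2 := by
    simp only [trace, diag_apply, mul_apply, star_apply, Complex.re_sum]
    refine Finset.sum_congr rfl fun l _ => Finset.sum_congr rfl fun k _ => ?_
    rw [← starRingEnd_apply, Complex.conj_mul', ← Complex.ofReal_pow, Complex.ofReal_re]
  have hcol : ∀ l, ∑ k, ‖B k l‖ ^ 2 ≤ ∑ l, ∑ k, ‖B k l‖ ^ 2 := fun l =>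
    Finset.single_le_sum (f := fun l => ∑ k, ‖B k l‖ ^ 2)
      (fun l _ => Finset.sum_nonneg fun k _ => by positivity) (Finset.mem_univ l)
  have hij : ‖(star B * B) i j‖ ≤ ∑ k, (‖B k i‖ ^ 2 + ‖B k j‖ ^ 2) / 2 := by
    rw [mul_apply]
    refine (norm_sum_le _ _).trans (Finset.sum_le_sum fun k _ => ?_)
    rw [norm_mul, star_apply, norm_star]
    linarith [two_mul_le_add_sq ‖B k i‖ ‖B k j‖]
  rw [← Finset.sum_div, Finset.sum_add_distrib] at hij
  rw [htr]
  linarith [hcol i, hcol j]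

theorem isClosed_setOf_posSemidef : IsClosed {Q : Matrix n n ℂ | Q.PosSemidef} := by
  simp only [posSemidef_iff_dotProduct_mulVec, Set.ofPred_and, Set.ofPred_forall]
  refine IsClosed.inter ?_ (isClosed_iInter fun x => ?_)
  · exact isClosed_eq (by fun_prop) continuous_id
  · exact isClosed_le continuous_const (by fun_prop)

/-- The positive semidefinite matrices of bounded trace form a compact set. -/
theorem isCompact_posSemidef_trace_le (P : ℝ) :
    IsCompact {Q : Matrix n n ℂ | Q.PosSemidef ∧ Q.trace.re ≤ P} := by
  have hbox : IsCompact (Set.pi Set.univ fun _ : n => Set.pi Set.univ fun _ : n =>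
      Metric.closedBall (0 : ℂ) P) :=
    isCompact_univ_pi fun _ => isCompact_univ_pi fun _ => isCompact_closedBall 0 P
  refine IsCompact.of_isClosed_subset hbox ?_ ?_
  · exact isClosed_setOf_posSemidef.inter
      (isClosed_le (Complex.continuous_re.comp continuous_id.matrix_trace) continuous_const)
  · intro Q hQ i _ j _
    rw [mem_closedBall_zero_iff]
    exact (hQ.1.norm_apply_le_trace i j).trans hQ.2

end Matrix

section Rate

variable {nT nR : ℕ} {H : Matrix (Fin nR) (Fin nT) ℂ} {Rw : Matrix (Fin nR) (Fin nR) ℂ}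

/-- Whitening the noise turns the rate determinant into that of a Hermitian matrix. -/
theorem exists_rate_det_eq (H : Matrix (Fin nR) (Fin nT) ℂ) (hRw : Rw.PosDef) :
    ∃ G : Matrix (Fin nR) (Fin nT) ℂ, ∀ Q : Matrix (Fin nT) (Fin nT) ℂ,
      (1 + Hᴴ * Rw⁻¹ * H * Q).det = (1 + G * Q * Gᴴ).det := by
  obtain ⟨B, -, hB⟩ := hRw.inv.exists_conjTranspose_mul_self
  refine ⟨B * H, fun Q => ?_⟩
  rw [det_one_add_mul_comm (B * H * Q), hB, conjTranspose_mul]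
  simp only [Matrix.mul_assoc]

theorem posDef_one_add_mul_mul_conjTranspose {Q : Matrix (Fin nT) (Fin nT) ℂ}
    (hQ : Q.PosSemidef) (G : Matrix (Fin nR) (Fin nT) ℂ) : (1 + G * Q * Gᴴ).PosDef :=
  PosDef.one.add_posSemidef (hQ.mul_mul_conjTranspose_same G)

theorem rate_concaveOn (H : Matrix (Fin nR) (Fin nT) ℂ) (hRw : Rw.PosDef) :
    ConcaveOn ℝ {Q | Q.PosSemidef} (rate H Rw) := by
  obtain ⟨G, hG⟩ := exists_rate_det_eq H hRw
  refine ⟨fun Q hQ Q' hQ' a b ha hb _ => (hQ.smul ha).add (hQ'.smul hb), ?_⟩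
  intro Q hQ Q' hQ' a b ha hb hab
  have hsplit : 1 + G * (a • Q + b • Q') * Gᴴ =
      a • (1 + G * Q * Gᴴ) + b • (1 + G * Q' * Gᴴ) := by
    simp only [Matrix.mul_add, Matrix.add_mul, Matrix.mul_smul, Matrix.smul_mul, smul_add]
    rw [add_add_add_comm, ← add_smul, hab, one_smul]
  have hlog := (posDef_one_add_mul_mul_conjTranspose hQ G).log_det_concave
    (posDef_one_add_mul_mul_conjTranspose hQ' G) ha hb hab
  simp only [rate, hG, hsplit, Real.logb, smul_eq_mul]
  rw [← mul_div_assoc, ← mul_div_assoc, ← add_div]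
  exact div_le_div_of_nonneg_right hlog (Real.log_nonneg one_le_two)

theorem rate_continuousOn (H : Matrix (Fin nR) (Fin nT) ℂ) (hRw : Rw.PosDef) :
    ContinuousOn (rate H Rw) {Q | Q.PosSemidef} := by
  obtain ⟨G, hG⟩ := exists_rate_det_eq H hRw
  refine ContinuousOn.div_const (ContinuousOn.log ?_ fun Q hQ => ?_) _
  · exact (Complex.continuous_re.comp (Continuous.matrix_det (by fun_prop))).continuousOn
  · rw [hG]
    exact (posDef_one_add_mul_mul_conjTranspose hQ G).det_re_pos.ne'

variable {c w fT PT Tt : ℝ}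

/-- Convexity of `k / x` on the positive reals, weakened by its monotonicity. -/
theorem pos_and_div_le_of_combo_le {k a b x y z : ℝ} (hk : 0 ≤ k) (ha : 0 ≤ a) (hb : 0 ≤ b)
    (hab : a + b = 1) (hx : 0 < x) (hy : 0 < y) (hz : a * x + b * y ≤ z) :
    0 < z ∧ k / z ≤ a * (k / x) + b * (k / y) := by
  have hpos : 0 < a * x + b * y := convex_Ioi (0 : ℝ) hx hy ha hb hab
  refine ⟨hpos.trans_le hz, (div_le_div_of_nonneg_left hk hpos hz).trans ?_⟩
  have hinv := (convexOn_zpow (𝕜 := ℝ) (-1)).2 hx hy ha hb hab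
  simp only [smul_eq_mul, _root_.zpow_neg_one] at hinv
  have := mul_le_mul_of_nonneg_left hinv hk
  simp only [div_eq_mul_inv]
  linarith

theorem convex_Xs (hRw : Rw.PosDef) (hc : 0 < c) (hw : 0 < w) :
    Convex ℝ (Xs H Rw c w fT PT Tt) := by
  rintro ⟨Q, f⟩ ⟨hQ, htr, hf, hfT, hr, hT⟩ ⟨Q', f'⟩ ⟨hQ', htr', hf', hfT', hr', hT'⟩ a b ha hb hab
  obtain ⟨hr₀, hr₁⟩ := pos_and_div_le_of_combo_le hc.le ha hb hab hr hr'
    ((rate_concaveOn H hRw).2 hQ hQ' ha hb hab)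
  obtain ⟨hf₀, hf₁⟩ := pos_and_div_le_of_combo_le hw.le ha hb hab hf hf' le_rfl
  refine ⟨(hQ.smul ha).add (hQ'.smul hb), ?_, hf₀, ?_, hr₀, ?_⟩
  · have h := convex_Iic PT htr htr' ha hb hab
    simpa [trace_add, trace_smul] using h
  · exact convex_Iic fT hfT hfT' ha hb hab
  · have h : a * (c / rate H Rw Q + w / f) + b * (c / rate H Rw Q' + w / f') ≤ Tt :=
      convex_Iic Tt hT hT' ha hb hab
    refine (add_le_add hr₁ hf₁).trans ?_
    linarith

/-- On positive reals, the latency constraint can be cleared of denominators. -/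
theorem latency_iff (hc : 0 < c) (hw : 0 < w) (hTt : 0 < Tt) {r f : ℝ} :
    (0 < f ∧ 0 < r ∧ c / r + w / f ≤ Tt) ↔
      (w / Tt ≤ f ∧ c / Tt ≤ r ∧ c * f + w * r ≤ Tt * (r * f)) := by
  constructor
  · rintro ⟨hf, hr, h⟩
    have h₁ := div_pos hc hr
    have h₂ := div_pos hw hf
    refine ⟨(div_le_comm₀ hf hTt).mp (by linarith), (div_le_comm₀ hr hTt).mp (by linarith), ?_⟩
    rw [div_add_div _ _ hr.ne' hf.ne', div_le_iff₀ (mul_pos hr hf)] at h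
    linarith
  · rintro ⟨hf, hr, h⟩
    have hf₀ := (div_pos hw hTt).trans_le hf
    have hr₀ := (div_pos hc hTt).trans_le hr
    refine ⟨hf₀, hr₀, ?_⟩
    rw [div_add_div _ _ hr₀.ne' hf₀.ne', div_le_iff₀ (mul_pos hr₀ hf₀)]
    linarith

theorem isCompact_Xs (hRw : Rw.PosDef) (hc : 0 < c) (hw : 0 < w) (hTt : 0 < Tt) :
    IsCompact (Xs H Rw c w fT PT Tt) := by
  have hK := (isCompact_posSemidef_trace_le (n := Fin nT) PT).prod
    (isCompact_Icc (a := w / Tt) (b := fT))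
  set K := {Q : Matrix (Fin nT) (Fin nT) ℂ | Q.PosSemidef ∧ Q.trace.re ≤ PT} ×ˢ
    Set.Icc (w / Tt) fT
  have hcont : ContinuousOn (fun p : Matrix (Fin nT) (Fin nT) ℂ × ℝ => (rate H Rw p.1, p.2)) K :=
    ((rate_continuousOn H hRw).comp continuousOn_fst fun p hp => hp.1.1).prodMk continuousOn_snd
  have hclosed : IsClosed {q : ℝ × ℝ | c / Tt ≤ q.1 ∧ c * q.2 + w * q.1 ≤ Tt * (q.1 * q.2)} :=
    (isClosed_Ici.preimage continuous_fst).inter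
      (isClosed_le (f := fun q : ℝ × ℝ => c * q.2 + w * q.1) (g := fun q => Tt * (q.1 * q.2))
        (by fun_prop) (by fun_prop))
  have heq : Xs H Rw c w fT PT Tt = K ∩ (fun p => (rate H Rw p.1, p.2)) ⁻¹'
      {q : ℝ × ℝ | c / Tt ≤ q.1 ∧ c * q.2 + w * q.1 ≤ Tt * (q.1 * q.2)} := by
    ext p
    have hiff := latency_iff (r := rate H Rw p.1) (f := p.2) hc hw hTt
    simp only [K, Xs, Set.mem_inter_iff, Set.mem_prod, Set.mem_Icc, Set.mem_preimage,
      Set.mem_ofPred_eq]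
    tauto
  rw [heq]
  exact hK.of_isClosed_subset (hcont.preimage_isClosed_of_isClosed hK.isClosed hclosed)
    Set.inter_subset_left

end Rate

/-- The feasible set `X_s` is a convex compact subset of (Hermitian matrices) × ℝ. -/
theorem Xs_convex_compact {nT nR : ℕ}
    (H : Matrix (Fin nR) (Fin nT) ℂ) (Rw : Matrix (Fin nR) (Fin nR) ℂ) (hRw : Rw.PosDef)
    (c w fT PT Tt : ℝ) (hc : 0 < c) (hw : 0 < w) (hfT : 0 < fT) (hPT : 0 < PT)
    (hTt : 0 < Tt) :
    Convex ℝ (Xs H Rw c w fT PT Tt) ∧ IsCompact (Xs H Rw c w fT PT Tt) := by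
  exact ⟨convex_Xs hRw hc hw, isCompact_Xs hRw hc hw hTt⟩
end

section
/- Fix (Q, f) with each Q_j (j ∈ I) Hermitian PSD, and fix a user i ∈ I with T̃_i > 0, f_i > w_i/T̃_i, and r_i(Q) > 0. Then the latency constraint c_i/r_i(Q) + w_i/f_i ≤ T̃_i holds if and only if there exists a Hermitian matrix Y_i with 0 ⪯ Y_i ⪯ I_i(Q) (Loewner order) such that log₂ det(σ²·I + Y_i) − log₂ det(R_{κ(i)}(Q)) ≥ c_i·f_i / (f_i·T̃_i − w_i); moreover, when the latency constraint holds, the choice Y_i = I_i(Q) satisfies this condition. (This is the per-constraint feasibility equivalence between the original offloading problem P and its slack-variable reformulation P̃.) -/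
open Matrix ComplexOrder

/-- Interference-plus-noise covariance at cell `n`:
`R_n(Q) = σ² I + Σ_{j : κ(j) ≠ n} H_{j,n} Q_j H_{j,n}ᴴ`. -/
noncomputable def Rn {ι : Type*} [Fintype ι] [DecidableEq ι] {Nc : ℕ}
    (nT : ι → ℕ) (nR : Fin Nc → ℕ) (κ : ι → Fin Nc)
    (Hc : ∀ i : ι, ∀ n : Fin Nc, Matrix (Fin (nR n)) (Fin (nT i)) ℂ) (σ2 : ℝ)
    (Q : ∀ i : ι, Matrix (Fin (nT i)) (Fin (nT i)) ℂ) (n : Fin Nc) :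
    Matrix (Fin (nR n)) (Fin (nR n)) ℂ :=
  σ2 • (1 : Matrix (Fin (nR n)) (Fin (nR n)) ℂ)
    + ∑ j ∈ Finset.univ.filter (fun j => κ j ≠ n), Hc j n * Q j * (Hc j n)ᴴ

/-- Achievable rate of user `i`:
`r_i(Q) = log₂ det(I + H_{i,κ(i)}ᴴ R_{κ(i)}(Q)⁻¹ H_{i,κ(i)} Q_i)`. -/
noncomputable def ri {ι : Type*} [Fintype ι] [DecidableEq ι] {Nc : ℕ}
    (nT : ι → ℕ) (nR : Fin Nc → ℕ) (κ : ι → Fin Nc)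
    (Hc : ∀ i : ι, ∀ n : Fin Nc, Matrix (Fin (nR n)) (Fin (nT i)) ℂ) (σ2 : ℝ)
    (Q : ∀ i : ι, Matrix (Fin (nT i)) (Fin (nT i)) ℂ) (i : ι) : ℝ :=
  Real.logb 2 ((1 + (Hc i (κ i))ᴴ * (Rn nT nR κ Hc σ2 Q (κ i))⁻¹
      * Hc i (κ i) * Q i).det).re

/-- Signal-plus-interference matrix of user `i`:
`I_i(Q) = H_{i,κ(i)} Q_i H_{i,κ(i)}ᴴ + Σ_{j : κ(j) ≠ κ(i)} H_{j,κ(i)} Q_j H_{j,κ(i)}ᴴ`. -/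
noncomputable def Ii {ι : Type*} [Fintype ι] [DecidableEq ι] {Nc : ℕ}
    (nT : ι → ℕ) (nR : Fin Nc → ℕ) (κ : ι → Fin Nc)
    (Hc : ∀ i : ι, ∀ n : Fin Nc, Matrix (Fin (nR n)) (Fin (nT i)) ℂ)
    (Q : ∀ i : ι, Matrix (Fin (nT i)) (Fin (nT i)) ℂ) (i : ι) :
    Matrix (Fin (nR (κ i))) (Fin (nR (κ i))) ℂ :=
  Hc i (κ i) * Q i * (Hc i (κ i))ᴴ
    + ∑ j ∈ Finset.univ.filter (fun j => κ j ≠ κ i), Hc j (κ i) * Q j * (Hc j (κ i))ᴴ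

/-- Adding a positive semidefinite matrix to the identity does not decrease the determinant. -/
theorem Matrix.PosSemidef.one_le_det_one_add {n : Type*} [Fintype n] [DecidableEq n]
    {P : Matrix n n ℂ} (hP : P.PosSemidef) : 1 ≤ (1 + P).det := by
  have h : (1 + P).det = ∏ i, (1 + (hP.1.eigenvalues i : ℂ)) := by
    have h1 := Matrix.eval_charpoly P (-1)
    rw [hP.1.charpoly_eq, Polynomial.eval_prod] at h1
    have h2 : Matrix.scalar n (-1 : ℂ) - P = -(1 + P) := by
      rw [map_neg, map_one]; abel
    have h3 : ∏ i, (-1 - (hP.1.eigenvalues i : ℂ))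
        = (-1) ^ Fintype.card n * ∏ i, (1 + (hP.1.eigenvalues i : ℂ)) := by
      rw [← Finset.card_univ, ← Finset.prod_const, ← Finset.prod_mul_distrib]
      exact Finset.prod_congr rfl fun i _ => by ring
    rw [h2, Matrix.det_neg] at h1
    simp only [Polynomial.eval_sub, Polynomial.eval_X, Polynomial.eval_C] at h1
    exact mul_left_cancel₀ (pow_ne_zero _ (by norm_num)) (h1.symm.trans h3)
  have h4 : ∀ i, 1 ≤ 1 + hP.1.eigenvalues i := fun i => by
    linarith [hP.eigenvalues_nonneg i]
  rw [h]
  exact_mod_cast Finset.one_le_prod fun i (_ : i ∈ Finset.univ) => h4 i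

/-- The determinant is monotone for the Loewner order above a positive definite matrix. -/
theorem Matrix.PosDef.det_le_det_add {n : Type*} [Fintype n] [DecidableEq n]
    {A B : Matrix n n ℂ} (hA : A.PosDef) (hB : B.PosSemidef) : A.det ≤ (A + B).det := by
  obtain ⟨C, rfl⟩ : ∃ C : Matrix n n ℂ, B = Cᴴ * C := by
    open scoped MatrixOrder in
    exact CStarAlgebra.nonneg_iff_eq_star_mul_self.mp hB.nonneg
  rw [Matrix.det_add_mul _ _ hA.det_pos.ne'.isUnit]
  exact le_mul_of_one_le_right hA.det_pos.le
    (hA.inv.posSemidef.mul_mul_conjTranspose_same C).one_le_det_one_add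

theorem Complex.re_pos_of_pos {z : ℂ} (hz : 0 < z) : 0 < z.re :=
  (Complex.pos_iff.mp hz).1

theorem posDef_real_smul_one {n : Type*} [Fintype n] [DecidableEq n] {s : ℝ} (hs : 0 < s) :
    (s • (1 : Matrix n n ℂ)).PosDef :=
  Matrix.PosDef.one.smul hs

section Rate

variable {ι : Type*} [Fintype ι] [DecidableEq ι] {Nc : ℕ}
    (nT : ι → ℕ) (nR : Fin Nc → ℕ) (κ : ι → Fin Nc)
    (Hc : ∀ i : ι, ∀ n : Fin Nc, Matrix (Fin (nR n)) (Fin (nT i)) ℂ) {σ2 : ℝ}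
    {Q : ∀ i : ι, Matrix (Fin (nT i)) (Fin (nT i)) ℂ}

theorem posDef_Rn (hσ2 : 0 < σ2) (hQ : ∀ j, (Q j).PosSemidef) (n : Fin Nc) :
    (Rn nT nR κ Hc σ2 Q n).PosDef :=
  (posDef_real_smul_one hσ2).add_posSemidef
    (Matrix.posSemidef_sum _ fun j _ => (hQ j).mul_mul_conjTranspose_same _)

theorem posSemidef_Ii (hQ : ∀ j, (Q j).PosSemidef) (i : ι) : (Ii nT nR κ Hc Q i).PosSemidef :=
  ((hQ i).mul_mul_conjTranspose_same _).add
    (Matrix.posSemidef_sum _ fun j _ => (hQ j).mul_mul_conjTranspose_same _)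

/-- The rate is the difference of two log-determinants. -/
theorem ri_eq_logb_sub_logb (hσ2 : 0 < σ2) (hQ : ∀ j, (Q j).PosSemidef) (i : ι) :
    ri nT nR κ Hc σ2 Q i
      = Real.logb 2 ((σ2 • (1 : Matrix (Fin (nR (κ i))) (Fin (nR (κ i))) ℂ)
            + Ii nT nR κ Hc Q i).det).re
          - Real.logb 2 ((Rn nT nR κ Hc σ2 Q (κ i)).det).re := by
  have hR := posDef_Rn nT nR κ Hc hσ2 hQ (κ i)
  have hS := (posDef_real_smul_one hσ2).add_posSemidef (posSemidef_Ii nT nR κ Hc hQ i)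
  have hdR := Complex.re_pos_of_pos hR.det_pos
  have hdS := Complex.re_pos_of_pos hS.det_pos
  have hdet : (σ2 • (1 : Matrix (Fin (nR (κ i))) (Fin (nR (κ i))) ℂ)
        + Ii nT nR κ Hc Q i).det
      = (Rn nT nR κ Hc σ2 Q (κ i)).det
        * (1 + (Hc i (κ i))ᴴ * (Rn nT nR κ Hc σ2 Q (κ i))⁻¹ * Hc i (κ i) * Q i).det := by
    have h : σ2 • (1 : Matrix (Fin (nR (κ i))) (Fin (nR (κ i))) ℂ) + Ii nT nR κ Hc Q i
        = Rn nT nR κ Hc σ2 Q (κ i) + Hc i (κ i) * Q i * (Hc i (κ i))ᴴ := by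
      unfold Ii Rn
      abel
    rw [h, Matrix.det_add_mul _ _ hR.det_pos.ne'.isUnit]
    simp only [Matrix.mul_assoc]
  have hre := congrArg Complex.re hdet
  rw [Complex.mul_re, ← (Complex.pos_iff.mp hR.det_pos).2, zero_mul, sub_zero] at hre
  have hne := right_ne_zero_of_mul (hre ▸ hdS.ne')
  rw [hre, Real.logb_mul hdR.ne' hne, ri]
  ring

end Rate

theorem div_add_div_le_iff_le {c r w f T : ℝ} (hr : 0 < r) (hf : 0 < f) (hfT : w < f * T) :
    c / r + w / f ≤ T ↔ c * f / (f * T - w) ≤ r := by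
  rw [div_add_div _ _ hr.ne' hf.ne', div_le_iff₀ (mul_pos hr hf), div_le_iff₀ (sub_pos.mpr hfT)]
  constructor <;> intro h <;> nlinarith

/-- Per-constraint equivalence between the latency constraint of the original
offloading problem `P` and its slack-variable reformulation `P̃`: the latency
constraint holds iff some `0 ⪯ Y ⪯ I_i(Q)` satisfies the slack constraint; moreover,
when the latency constraint holds, `Y = I_i(Q)` is such a choice. -/
theorem latency_slack_equivalence {ι : Type*} [Fintype ι] [DecidableEq ι] {Nc : ℕ}
    (nT : ι → ℕ) (nR : Fin Nc → ℕ) (κ : ι → Fin Nc)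
    (Hc : ∀ i : ι, ∀ n : Fin Nc, Matrix (Fin (nR n)) (Fin (nT i)) ℂ)
    (σ2 : ℝ) (hσ2 : 0 < σ2)
    (Q : ∀ i : ι, Matrix (Fin (nT i)) (Fin (nT i)) ℂ) (hQ : ∀ j, (Q j).PosSemidef)
    (f : ι → ℝ) (i : ι) (cI wI Tt : ι → ℝ)
    (hcI : 0 < cI i) (hwI : 0 < wI i) (hTt : 0 < Tt i)
    (hf : wI i / Tt i < f i) (hr : 0 < ri nT nR κ Hc σ2 Q i) :
    (cI i / ri nT nR κ Hc σ2 Q i + wI i / f i ≤ Tt i ↔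
      ∃ Y : Matrix (Fin (nR (κ i))) (Fin (nR (κ i))) ℂ,
        Y.PosSemidef ∧ (Ii nT nR κ Hc Q i - Y).PosSemidef ∧
        Real.logb 2 ((σ2 • (1 : Matrix (Fin (nR (κ i))) (Fin (nR (κ i))) ℂ) + Y).det).re
            - Real.logb 2 ((Rn nT nR κ Hc σ2 Q (κ i)).det).re
          ≥ cI i * f i / (f i * Tt i - wI i)) ∧
    (cI i / ri nT nR κ Hc σ2 Q i + wI i / f i ≤ Tt i →
      (Ii nT nR κ Hc Q i).PosSemidef ∧
      Real.logb 2 ((σ2 • (1 : Matrix (Fin (nR (κ i))) (Fin (nR (κ i))) ℂ)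
            + Ii nT nR κ Hc Q i).det).re
          - Real.logb 2 ((Rn nT nR κ Hc σ2 Q (κ i)).det).re
        ≥ cI i * f i / (f i * Tt i - wI i)) := by
  have hf0 : 0 < f i := (div_pos hwI hTt).trans hf
  have hfT : wI i < f i * Tt i := (div_lt_iff₀ hTt).mp hf
  have hI := posSemidef_Ii nT nR κ Hc hQ i
  rw [div_add_div_le_iff_le hr hf0 hfT, ri_eq_logb_sub_logb nT nR κ Hc hσ2 hQ i]
  refine ⟨⟨fun h => ⟨_, hI, by simpa using Matrix.PosSemidef.zero, h⟩, ?_⟩, fun h => ⟨hI, h⟩⟩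
  rintro ⟨Y, hY, hIY, h⟩
  have hS := (posDef_real_smul_one hσ2).add_posSemidef hY
  have hle := hS.det_le_det_add hIY
  rw [add_assoc, add_sub_cancel] at hle
  refine le_trans h (sub_le_sub_right ?_ _)
  exact Real.logb_le_logb_of_le one_lt_two (Complex.re_pos_of_pos hS.det_pos)
    (Complex.le_def.mp hle).1
end
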